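/- arXiv:1602.02837 — 6 statements merged into one kernel-verified Lean document; each statement's English description precedes it below -/
import Mathlib

section
/- Let f_m, m = 0, 1, 2, …, be homogeneous polynomials on ℝ^n with f_m of degree m. If lim_{m→∞} ( max_{θ ∈ S^{n-1}} |f_m(θ)| )^{1/m} = 0, then the series Σ_{m=0}^∞ f_m converges absolutely and uniformly on every compact subset of ℝ^n, and the function f(x) = Σ_{m=0}^∞ f_m(x) extends to an entire function on ℂ^n (equivalently, with complexified arguments the series Σ f_m(z) converges locally uniformly on all of ℂ^n). -/
open MvPolynomial Filter

/-- `max_{θ ∈ S^{n-1}} |p(θ)|`, the maximum of a polynomial over the (Euclidean) unit sphere. -/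
noncomputable def sphereMax (n : ℕ) (p : MvPolynomial (Fin n) ℝ) : ℝ :=
  ⨆ θ ∈ Metric.sphere (0 : EuclideanSpace ℝ (Fin n)) 1, |eval (θ : Fin n → ℝ) p|

namespace MvPolynomial

theorem IsHomogeneous.eval_smul {σ R : Type*} [CommSemiring R] {p : MvPolynomial σ R} {m : ℕ}
    (hp : p.IsHomogeneous m) (c : R) (x : σ → R) : eval (c • x) p = c ^ m * eval x p := by
  rw [eval_eq, eval_eq, Finset.mul_sum]
  refine Finset.sum_congr rfl fun d hd => ?_
  simp only [Pi.smul_apply, smul_eq_mul, mul_pow, Finset.prod_mul_distrib,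
    Finset.prod_pow_eq_pow_sum]
  rw [← hp.degree_eq_sum_deg_support hd]
  ring

theorem differentiable_eval_comp {σ E : Type*} [NormedAddCommGroup E] [NormedSpace ℂ E]
    {g : E → σ → ℂ} (hg : ∀ i, Differentiable ℂ fun w => g w i) (p : MvPolynomial σ ℂ) :
    Differentiable ℂ fun w => eval (g w) p := by
  induction p using MvPolynomial.induction_on with
  | C a => simp
  | add p q hp hq => simpa using hp.fun_add hq
  | mul_X p i hp => simpa using hp.fun_mul (hg i)

theorem eval_ofReal_map {σ : Type*} (p : MvPolynomial σ ℝ) (x : σ → ℝ) :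
    eval (fun i => (x i : ℂ)) (p.map (algebraMap ℝ ℂ)) = (eval x p : ℝ) := by
  induction p using MvPolynomial.induction_on with
  | C a => simp
  | add p q hp hq => simp [hp, hq]
  | mul_X p i hp => simp [hp]

end MvPolynomial

theorem abs_eval_le_sphereMax {n : ℕ} (p : MvPolynomial (Fin n) ℝ)
    {θ : EuclideanSpace ℝ (Fin n)} (hθ : θ ∈ Metric.sphere (0 : EuclideanSpace ℝ (Fin n)) 1) :
    |eval (θ : Fin n → ℝ) p| ≤ sphereMax n p := by
  have hcont : Continuous fun θ : EuclideanSpace ℝ (Fin n) => |eval (θ : Fin n → ℝ) p| :=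
    ((MvPolynomial.continuous_eval p).comp (PiLp.continuous_ofLp 2 _)).abs
  obtain ⟨B, hB⟩ := (isCompact_sphere (0 : EuclideanSpace ℝ (Fin n)) 1).bddAbove_image
    hcont.continuousOn
  have hbdd : BddAbove (Set.range fun θ : EuclideanSpace ℝ (Fin n) =>
      ⨆ _ : θ ∈ Metric.sphere (0 : EuclideanSpace ℝ (Fin n)) 1, |eval (θ : Fin n → ℝ) p|) := by
    refine ⟨max B 0, ?_⟩
    rintro _ ⟨x, rfl⟩
    refine Real.iSup_le (fun hx => ?_) (le_max_right _ _)
    exact (hB ⟨x, hx, rfl⟩).trans (le_max_left _ _)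
  refine le_trans ?_ (le_ciSup hbdd θ)
  simp only [ciSup_pos hθ, le_refl]

theorem sphereMax_nonneg (n : ℕ) (p : MvPolynomial (Fin n) ℝ) : 0 ≤ sphereMax n p :=
  Real.iSup_nonneg fun _ => Real.iSup_nonneg fun _ => abs_nonneg _

theorem abs_eval_le_sphereMax_mul_norm_pow {n : ℕ} (hn : 1 ≤ n) {p : MvPolynomial (Fin n) ℝ}
    {m : ℕ} (hp : p.IsHomogeneous m) (x : EuclideanSpace ℝ (Fin n)) :
    |eval (x : Fin n → ℝ) p| ≤ sphereMax n p * ‖x‖ ^ m := by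
  obtain ⟨θ, hθ, hx⟩ : ∃ θ ∈ Metric.sphere (0 : EuclideanSpace ℝ (Fin n)) 1, x = ‖x‖ • θ := by
    rcases eq_or_ne x 0 with rfl | hx
    · exact ⟨EuclideanSpace.single ⟨0, hn⟩ 1, by simp, by simp⟩
    · exact ⟨‖x‖⁻¹ • x, by simp [norm_smul, hx], by simp [smul_smul, hx]⟩
  have h : eval (x : Fin n → ℝ) p = ‖x‖ ^ m * eval (θ : Fin n → ℝ) p := by
    rw [← hp.eval_smul, ← WithLp.ofLp_smul, ← hx]
  rw [h, abs_mul, abs_of_nonneg (by positivity), mul_comm]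
  gcongr
  exact abs_eval_le_sphereMax p hθ

/-- A bound for a homogeneous polynomial at complex points in terms of its size on the real sphere.
It follows from the maximum principle for `w ↦ p (w x + (w ^ 2 + 1) / 2 y)` on the unit disc: on
the unit circle the argument is `w` times the real vector `x + (re w) y`. -/
theorem norm_eval_map_le {n : ℕ} (hn : 1 ≤ n) {p : MvPolynomial (Fin n) ℝ} {m : ℕ}
    (hp : p.IsHomogeneous m) (z : EuclideanSpace ℂ (Fin n)) :
    ‖eval (z : Fin n → ℂ) (p.map (algebraMap ℝ ℂ))‖ ≤ sphereMax n p * (5 * ‖z‖) ^ m := by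
  let a : EuclideanSpace ℝ (Fin n) := WithLp.toLp 2 fun i => (z i).re
  let b : EuclideanSpace ℝ (Fin n) := WithLp.toLp 2 fun i => (z i).im
  have ha : ‖a‖ ≤ ‖z‖ := by
    rw [EuclideanSpace.norm_eq, EuclideanSpace.norm_eq]
    gcongr with i
    exact Complex.abs_re_le_norm (z i)
  have hb : ‖b‖ ≤ ‖z‖ := by
    rw [EuclideanSpace.norm_eq, EuclideanSpace.norm_eq]
    gcongr with i
    exact Complex.abs_im_le_norm (z i)
  let g : ℂ → Fin n → ℂ := fun w i =>
    w * (2 * (z i).im : ℝ) + (w ^ 2 + 1) / 2 * (8 / 3 * (z i).re : ℝ)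
  have hg : Differentiable ℂ fun w => eval (g w) (p.map (algebraMap ℝ ℂ)) :=
    differentiable_eval_comp (fun i => by fun_prop) _
  have hz : g (Complex.I / 2) = z := by
    funext i
    simp only [g, div_pow, Complex.I_sq]
    conv_rhs => rw [← Complex.re_add_im (z i)]
    push_cast
    ring
  rw [← hz]
  refine Complex.norm_le_of_forall_mem_frontier_norm_le (U := Metric.ball 0 1)
    Metric.isBounded_ball hg.diffContOnCl (fun w hw => ?_) (subset_closure (by simp; norm_num))
  replace hw : ‖w‖ = 1 := by simpa using Metric.frontier_ball_subset_sphere hw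
  let v : EuclideanSpace ℝ (Fin n) := (2 : ℝ) • b + (w.re * (8 / 3)) • a
  have hgw : g w = w • fun i => (v i : ℂ) := by
    have hw2 : w ^ 2 + 1 = w * (2 * w.re) := by
      have h1 : w * (starRingEnd ℂ) w = 1 := by simp [Complex.mul_conj', hw]
      have h2 := Complex.add_conj w
      push_cast at h2
      rw [← h2, mul_add, h1, sq]
    funext i
    simp only [g, v, a, b, hw2, Pi.smul_apply, smul_eq_mul, PiLp.add_apply, PiLp.smul_apply]
    push_cast
    ring
  have hv : ‖v‖ ≤ 5 * ‖z‖ := by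
    have hre : |w.re| ≤ 1 := hw ▸ Complex.abs_re_le_norm w
    calc ‖v‖ ≤ 2 * ‖b‖ + |w.re| * (8 / 3) * ‖a‖ := by
          refine (norm_add_le _ _).trans_eq ?_
          simp [norm_smul]
      _ ≤ 2 * ‖z‖ + 1 * (8 / 3) * ‖z‖ := by gcongr
      _ ≤ 5 * ‖z‖ := by linarith [norm_nonneg z]
  rw [hgw, (hp.map _).eval_smul, eval_ofReal_map, norm_mul, norm_pow, hw, one_pow, one_mul,
    Complex.norm_real, Real.norm_eq_abs]
  refine (abs_eval_le_sphereMax_mul_norm_pow hn hp v).trans ?_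
  have := sphereMax_nonneg n p
  gcongr

theorem summable_mul_pow_of_tendsto_rpow_zero {M : ℕ → ℝ} (hM : ∀ m, 0 ≤ M m)
    (hlim : Tendsto (fun m : ℕ => M m ^ (1 / (m : ℝ))) atTop (nhds 0)) {R : ℝ} (hR : 0 < R) :
    Summable fun m => M m * R ^ m := by
  refine summable_of_isBigO_nat summable_geometric_two ?_
  refine Asymptotics.IsBigO.of_bound 1 ?_
  filter_upwards [hlim.eventually (ge_mem_nhds (show (0 : ℝ) < 1 / 2 / R by positivity)),
    eventually_gt_atTop 0] with m hm hm0
  have h : M m ≤ (1 / 2 / R) ^ m := by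
    calc M m = (M m ^ (1 / (m : ℝ))) ^ m := by
          rw [one_div, Real.rpow_inv_natCast_pow (hM m) hm0.ne']
      _ ≤ _ := by
          have := Real.rpow_nonneg (hM m) (1 / (m : ℝ))
          gcongr
  have h0 : 0 ≤ M m * R ^ m := mul_nonneg (hM m) (by positivity)
  rw [Real.norm_of_nonneg h0, Real.norm_of_nonneg (by positivity), one_mul]
  calc M m * R ^ m ≤ (1 / 2 / R) ^ m * R ^ m := by gcongr
    _ = (1 / 2) ^ m := by rw [← mul_pow, div_mul_cancel₀ _ hR.ne']

/-- A series of entire functions that is dominated on each ball by a summable series has an entire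
sum. -/
theorem differentiable_tsum_of_summable_norm_ball {E : Type*} [NormedAddCommGroup E]
    [NormedSpace ℂ E] {f : ℕ → E → ℂ} (hf : ∀ m, Differentiable ℂ (f m)) {u : ℝ → ℕ → ℝ}
    (hu : ∀ R, 0 < R → Summable (u R)) (hfu : ∀ R, 0 < R → ∀ m z, ‖z‖ ≤ R → ‖f m z‖ ≤ u R m) :
    Differentiable ℂ fun z => ∑' m, f m z := by
  intro z
  have hR : 0 < ‖z‖ + 2 := by positivity
  have hsub {x y : E} (hx : x ∈ Metric.ball (0 : E) (‖z‖ + 1)) (hy : y ∈ Metric.ball x 1) :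
      ‖y‖ ≤ ‖z‖ + 2 := by
    rw [mem_ball_zero_iff] at hx
    rw [mem_ball_iff_norm] at hy
    linarith [norm_le_norm_add_norm_sub x y, norm_sub_rev x y]
  have hderiv (m : ℕ) (x : E) (hx : x ∈ Metric.ball (0 : E) (‖z‖ + 1)) :
      ‖fderiv ℂ (f m) x‖ ≤ 2 * u (‖z‖ + 2) m := by
    have h := Complex.norm_fderiv_le_div_of_mapsTo_ball (f := f m) (c := x) (R₁ := 1)
      (R₂ := 2 * u (‖z‖ + 2) m) (hf m).differentiableOn (fun y hy => ?_) one_pos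
    · simpa using h
    · rw [mem_closedBall_iff_norm]
      have h1 := hfu _ hR m y (hsub hx hy)
      have h2 := hfu _ hR m x (hsub hx (Metric.mem_ball_self one_pos))
      linarith [norm_sub_le (f m y) (f m x)]
  have hz : z ∈ Metric.ball (0 : E) (‖z‖ + 1) := by simp
  exact (hasFDerivAt_tsum_of_isPreconnected ((hu _ hR).mul_left 2) Metric.isOpen_ball
    (convex_ball (0 : E) _).isPreconnected (fun m x _ => (hf m x).hasFDerivAt) hderiv hz
    ((hu _ hR).of_norm_bounded fun m => hfu _ hR m z (by linarith)) hz).differentiableAt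

/-- If `lim (max_{S^{n-1}} |f_m|)^{1/m} = 0`, then `∑ f_m` converges absolutely and uniformly
on every compact subset of `ℝⁿ`, and its sum extends to an entire function on `ℂⁿ`:
the complexified series converges (to a holomorphic function) on all of `ℂⁿ`. -/
theorem entire_of_lim_zero
    (n : ℕ) (hn : 1 ≤ n) (f : ℕ → MvPolynomial (Fin n) ℝ)
    (hhom : ∀ m, (f m).IsHomogeneous m)
    (hlim : Tendsto (fun m : ℕ => (sphereMax n (f m)) ^ (1 / (m : ℝ))) atTop (nhds 0)) :
    (∀ K : Set (EuclideanSpace ℝ (Fin n)), IsCompact K →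
      (∀ x ∈ K, Summable (fun m => |eval (x : Fin n → ℝ) (f m)|)) ∧
      TendstoUniformlyOn
        (fun N (x : EuclideanSpace ℝ (Fin n)) =>
          ∑ m ∈ Finset.range N, eval (x : Fin n → ℝ) (f m))
        (fun x => ∑' m, eval (x : Fin n → ℝ) (f m)) atTop K) ∧
    ∃ F : EuclideanSpace ℂ (Fin n) → ℂ, Differentiable ℂ F ∧
      ∀ z : EuclideanSpace ℂ (Fin n),
        HasSum (fun m => eval (z : Fin n → ℂ) ((f m).map (algebraMap ℝ ℂ))) (F z) := by
  have hM m : 0 ≤ sphereMax n (f m) := sphereMax_nonneg n (f m)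
  refine ⟨fun K hK => ?_, ?_⟩
  · obtain ⟨R, hR, hKR⟩ := hK.isBounded.exists_pos_norm_le
    have hsum := summable_mul_pow_of_tendsto_rpow_zero hM hlim hR
    have hbound (m : ℕ) (x : EuclideanSpace ℝ (Fin n)) (hx : x ∈ K) :
        ‖eval (x : Fin n → ℝ) (f m)‖ ≤ sphereMax n (f m) * R ^ m :=
      (abs_eval_le_sphereMax_mul_norm_pow hn (hhom m) x).trans
        (mul_le_mul_of_nonneg_left (pow_le_pow_left₀ (norm_nonneg x) (hKR x hx) m) (hM m))
    exact ⟨fun x hx => hsum.of_nonneg_of_le (fun m => abs_nonneg _) fun m => hbound m x hx,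
      tendstoUniformlyOn_tsum_nat hsum hbound⟩
  · have hsum (R : ℝ) (hR : 0 < R) : Summable fun m => sphereMax n (f m) * (5 * R) ^ m :=
      summable_mul_pow_of_tendsto_rpow_zero hM hlim (by positivity)
    have hbound (R : ℝ) (_ : 0 < R) (m : ℕ) (z : EuclideanSpace ℂ (Fin n)) (hz : ‖z‖ ≤ R) :
        ‖eval (z : Fin n → ℂ) ((f m).map (algebraMap ℝ ℂ))‖ ≤ sphereMax n (f m) * (5 * R) ^ m := by
      refine (norm_eval_map_le hn (hhom m) z).trans ?_
      have := hM m
      gcongr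
    refine ⟨fun z => ∑' m, eval (z : Fin n → ℂ) ((f m).map (algebraMap ℝ ℂ)),
      differentiable_tsum_of_summable_norm_ball
        (fun m => differentiable_eval_comp (fun i => by fun_prop) _) hsum hbound, fun z => ?_⟩
    have hz : 0 < ‖z‖ + 1 := by positivity
    exact ((hsum _ hz).of_norm_bounded fun m => hbound _ hz m z (by linarith)).hasSum
end

section
/- Let f be an entire function on ℂ^n of order ρ with 0 < ρ < ∞ and type τ, and let f = Σ_{m=0}^∞ f_m be its expansion into homogeneous polynomials f_m of degree m. Then limsup_{m→∞} m · ( max_{|z|=1} |f_m(z)| )^{ρ/m} = e ρ τ. -/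
open MvPolynomial Filter

/-- `M(F; r) = sup {‖F z‖ : |z| = r}`. -/
noncomputable def Mf (n : ℕ) (F : EuclideanSpace ℂ (Fin n) → ℂ) (r : ℝ) : ℝ :=
  ⨆ z ∈ Metric.sphere (0 : EuclideanSpace ℂ (Fin n)) r, ‖F z‖

/-- The order `ρ(F) = limsup_{r→∞} log log M(F;r) / log r` of an entire function. -/
noncomputable def entireOrder (n : ℕ) (F : EuclideanSpace ℂ (Fin n) → ℂ) : EReal :=
  limsup (fun r : ℝ => ((Real.log (Real.log (Mf n F r)) / Real.log r : ℝ) : EReal)) atTop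

/-- The type `τ(F) = limsup_{r→∞} log M(F;r) / r^ρ` of an entire function of order `ρ`. -/
noncomputable def entireType (n : ℕ) (F : EuclideanSpace ℂ (Fin n) → ℂ) (ρ : ℝ) : EReal :=
  limsup (fun r : ℝ => ((Real.log (Mf n F r) / r ^ ρ : ℝ) : EReal)) atTop

/-- `max_{|z| = 1} |p(z)|` over the (Euclidean) unit sphere of `ℂⁿ`. -/
noncomputable def sphereMaxC (n : ℕ) (p : MvPolynomial (Fin n) ℂ) : ℝ :=
  ⨆ z ∈ Metric.sphere (0 : EuclideanSpace ℂ (Fin n)) 1, ‖eval (z : Fin n → ℂ) p‖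

section SphereSup

variable {E : Type*} [NormedAddCommGroup E]

theorem norm_le_iSup_sphere [ProperSpace E] {G : E → ℂ} (hG : Continuous G) {r : ℝ} {z : E}
    (hz : z ∈ Metric.sphere (0 : E) r) :
    ‖G z‖ ≤ ⨆ z ∈ Metric.sphere (0 : E) r, ‖G z‖ := by
  obtain ⟨B, hB⟩ := (isCompact_sphere (0 : E) r).exists_bound_of_continuousOn hG.continuousOn
  have hB0 : 0 ≤ B := (norm_nonneg _).trans (hB z hz)
  have hbdd : BddAbove (Set.range fun z => ⨆ _ : z ∈ Metric.sphere (0 : E) r, ‖G z‖) := by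
    refine ⟨B, ?_⟩
    rintro _ ⟨w, rfl⟩
    exact Real.iSup_le (hB w) hB0
  refine le_ciSup_of_le hbdd z ?_
  rw [ciSup_pos hz]

theorem iSup_sphere_norm_le {G : E → ℂ} {r B : ℝ} (hB0 : 0 ≤ B)
    (hB : ∀ z ∈ Metric.sphere (0 : E) r, ‖G z‖ ≤ B) :
    ⨆ z ∈ Metric.sphere (0 : E) r, ‖G z‖ ≤ B :=
  Real.iSup_le (fun z => Real.iSup_le (hB z) hB0) hB0

theorem iSup_sphere_norm_nonneg (G : E → ℂ) (r : ℝ) :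
    0 ≤ ⨆ z ∈ Metric.sphere (0 : E) r, ‖G z‖ :=
  Real.iSup_nonneg fun _ => Real.iSup_nonneg fun _ => norm_nonneg _

end SphereSup

/-- Cauchy's estimate for the coefficients of an everywhere convergent power series. -/
theorem norm_coeff_mul_pow_le_of_hasSum {a : ℕ → ℂ} {g : ℂ → ℂ}
    (hg : ∀ w, HasSum (fun m => a m * w ^ m) (g w)) {r B : ℝ} (hr : 0 < r)
    (hB : ∀ w ∈ Metric.sphere (0 : ℂ) r, ‖g w‖ ≤ B) (m : ℕ) :
    ‖a m‖ * r ^ m ≤ B := by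
  have hrad : (FormalMultilinearSeries.ofScalars ℂ a).radius = ⊤ := by
    refine ENNReal.eq_top_of_forall_nnreal_le fun s => ?_
    refine FormalMultilinearSeries.le_radius_of_tendsto _ (l := 0) ?_
    have h := (hg ((s : ℝ) : ℂ)).summable.tendsto_atTop_zero.norm
    simpa [FormalMultilinearSeries.ofScalars_norm] using h
  have hps : HasFPowerSeriesOnBall g (FormalMultilinearSeries.ofScalars ℂ a) 0 ⊤ := by
    refine ⟨hrad.ge, by simp, fun {y} _ => ?_⟩
    simpa [FormalMultilinearSeries.ofScalars_apply_eq, mul_comm] using hg y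
  have hdiff : Differentiable ℂ g := by
    have h := hps.differentiableOn
    intro w
    exact h.differentiableAt (by simp)
  have hC := Complex.norm_iteratedDeriv_le_of_forall_mem_sphere_norm_le m hr
    hdiff.diffContOnCl hB
  have hcoef : (m.factorial : ℂ) * a m = iteratedDeriv m g 0 := by
    have := hps.factorial_smul (1 : ℂ) m
    rw [iteratedDeriv_eq_iteratedFDeriv, ← this]
    simp
  rw [← hcoef, norm_mul, Complex.norm_natCast, mul_div_assoc] at hC
  rw [← le_div_iff₀ (by positivity)]
  exact le_of_mul_le_mul_left hC (by positivity)

theorem MvPolynomial.IsHomogeneous.eval_mul {σ R : Type*} [Fintype σ] [CommSemiring R]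
    {p : MvPolynomial σ R} {m : ℕ} (hp : p.IsHomogeneous m) (c : R) (x : σ → R) :
    eval (fun i => c * x i) p = eval x p * c ^ m := by
  rw [eval_eq, eval_eq, Finset.sum_mul]
  refine Finset.sum_congr rfl fun d hd => ?_
  have hdeg := hp (mem_support_iff.mp hd)
  rw [Finsupp.weight_apply, Finsupp.sum_fintype _ _ (by simp)] at hdeg
  simp only [Pi.one_apply, smul_eq_mul, mul_one] at hdeg
  have hprod : ∏ i ∈ d.support, (c * x i) ^ d i = c ^ m * ∏ i ∈ d.support, x i ^ d i := by
    simp_rw [mul_pow]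
    rw [Finset.prod_mul_distrib, Finset.prod_pow_eq_pow_sum, ← hdeg]
    congr 2
    exact Finset.sum_subset (Finset.subset_univ _) fun i _ hi => by simpa using hi
  rw [hprod]
  ring

theorem continuous_eval_euclidean {n : ℕ} (p : MvPolynomial (Fin n) ℂ) :
    Continuous fun z : EuclideanSpace ℂ (Fin n) => eval (z : Fin n → ℂ) p :=
  (MvPolynomial.continuous_eval p).comp (PiLp.continuous_ofLp 2 _)

theorem norm_eval_le_sphereMaxC_mul_pow {n m : ℕ} {p : MvPolynomial (Fin n) ℂ}
    (hp : p.IsHomogeneous m) {r : ℝ} (hr : 0 < r) {z : EuclideanSpace ℂ (Fin n)}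
    (hz : z ∈ Metric.sphere (0 : EuclideanSpace ℂ (Fin n)) r) :
    ‖eval (z : Fin n → ℂ) p‖ ≤ sphereMaxC n p * r ^ m := by
  rw [mem_sphere_zero_iff_norm] at hz
  have hr' : (r : ℂ) ≠ 0 := by exact_mod_cast hr.ne'
  set w : EuclideanSpace ℂ (Fin n) := ((r : ℂ)⁻¹) • z with hw
  have hw1 : w ∈ Metric.sphere (0 : EuclideanSpace ℂ (Fin n)) 1 := by
    rw [mem_sphere_zero_iff_norm, hw, norm_smul, hz, norm_inv, Complex.norm_real,
      Real.norm_of_nonneg hr.le, inv_mul_cancel₀ hr.ne']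
  have hzw : (z : Fin n → ℂ) = fun i => (r : ℂ) * w i := by
    ext i
    simp [hw, hr']
  rw [hzw, hp.eval_mul, norm_mul, norm_pow, Complex.norm_real, Real.norm_of_nonneg hr.le]
  gcongr
  exact norm_le_iSup_sphere (continuous_eval_euclidean p) hw1

/-- Cauchy's estimate for the homogeneous components of an entire function on `ℂⁿ`. -/
theorem sphereMaxC_mul_pow_le_Mf {n : ℕ} {F : EuclideanSpace ℂ (Fin n) → ℂ}
    (hF : Continuous F) {fm : ℕ → MvPolynomial (Fin n) ℂ} (hhom : ∀ m, (fm m).IsHomogeneous m)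
    (hsum : ∀ z : EuclideanSpace ℂ (Fin n),
      HasSum (fun m => eval (z : Fin n → ℂ) (fm m)) (F z)) {r : ℝ} (hr : 0 < r) (m : ℕ) :
    sphereMaxC n (fm m) * r ^ m ≤ Mf n F r := by
  rw [← le_div_iff₀ (by positivity)]
  refine iSup_sphere_norm_le (div_nonneg (iSup_sphere_norm_nonneg F r) (by positivity)) ?_
  intro z hz
  rw [mem_sphere_zero_iff_norm] at hz
  rw [le_div_iff₀ (by positivity)]
  refine norm_coeff_mul_pow_le_of_hasSum (a := fun k => eval (z : Fin n → ℂ) (fm k))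
    (g := fun w => F (w • z)) (fun w => ?_) hr (fun w hw => ?_) m
  · have h := hsum (w • z)
    have heq : ∀ k, eval ((w • z : EuclideanSpace ℂ (Fin n)) : Fin n → ℂ) (fm k)
        = eval (z : Fin n → ℂ) (fm k) * w ^ k := fun k => (hhom k).eval_mul w _
    simpa only [heq] using h
  · refine norm_le_iSup_sphere hF ?_
    rw [mem_sphere_zero_iff_norm] at hw ⊢
    rw [norm_smul, hw, hz, mul_one]

theorem exp_one_mul_rpow_le {w y : ℝ} (hw : 0 ≤ w) (hy : 0 ≤ y) :
    (Real.exp 1 * w) ^ y ≤ Real.exp (w * y) := by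
  have h : Real.exp 1 * w ≤ Real.exp w := by
    have h1 := Real.add_one_le_exp (w - 1)
    calc Real.exp 1 * w ≤ Real.exp 1 * Real.exp (w - 1) := by gcongr; linarith
      _ = Real.exp w := by rw [← Real.exp_add]; congr 1; ring
  calc (Real.exp 1 * w) ^ y ≤ Real.exp w ^ y := by gcongr
    _ = Real.exp (w * y) := (Real.exp_mul w y).symm

section Growth

variable {C : ℕ → ℝ} {M : ℝ → ℝ} {ρ a b : ℝ}

/-- A growth bound of finite type forces decay of the coefficients. -/
theorem eventually_mul_rpow_le_of_growth (hC : ∀ m, 0 ≤ C m) (hρ : 0 < ρ) (hb : 0 < b)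
    (hCM : ∀ r, 0 < r → ∀ m, C m * r ^ m ≤ M r)
    (hM : ∀ᶠ r in atTop, Real.log (M r) ≤ b * r ^ ρ) :
    ∀ᶠ m : ℕ in atTop, (m : ℝ) * C m ^ (ρ / m) ≤ Real.exp 1 * ρ * b := by
  have htend : Tendsto (fun m : ℕ => ((m : ℝ) / (ρ * b)) ^ (1 / ρ)) atTop atTop :=
    (tendsto_rpow_atTop (by positivity)).comp
      (tendsto_natCast_atTop_atTop.atTop_div_const (by positivity))
  filter_upwards [htend.eventually hM, eventually_gt_atTop 0] with m hm hm0
  have hm0' : (0 : ℝ) < m := by exact_mod_cast hm0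
  set r : ℝ := ((m : ℝ) / (ρ * b)) ^ (1 / ρ) with hr
  have hr0 : 0 < r := by positivity
  have hrρ : r ^ ρ = m / (ρ * b) := by
    rw [hr, ← Real.rpow_mul (by positivity), one_div_mul_cancel hρ.ne', Real.rpow_one]
  have h1 : C m * r ^ m ≤ Real.exp (m / ρ) := by
    refine (hCM r hr0 m).trans ((Real.le_exp_log _).trans (Real.exp_le_exp.mpr ?_))
    rw [hrρ] at hm
    refine hm.trans_eq ?_
    field_simp
  have h2 : (C m * r ^ m) ^ (ρ / m) ≤ Real.exp (m / ρ) ^ (ρ / m) :=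
    Real.rpow_le_rpow (mul_nonneg (hC m) (by positivity)) h1 (by positivity)
  have h3 : Real.exp (m / ρ) ^ (ρ / m) = Real.exp 1 := by
    rw [← Real.exp_mul]; congr 1; field_simp
  have h4 : (r ^ m) ^ (ρ / m) = m / (ρ * b) := by
    rw [← Real.rpow_natCast, ← Real.rpow_mul hr0.le, ← hrρ]; congr 1; field_simp
  rw [Real.mul_rpow (hC m) (by positivity), h3, h4, ← mul_div_assoc,
    div_le_iff₀ (by positivity)] at h2
  linarith

/-- Decay of the coefficients bounds every term of the power series by a summable multiple of
`exp (b * r ^ ρ)`. -/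
theorem exists_summable_mul_pow_le_exp (hC : ∀ m, 0 ≤ C m) (hρ : 0 < ρ) (ha : 0 < a)
    (hab : a < b) (h : ∀ᶠ m : ℕ in atTop, (m : ℝ) * C m ^ (ρ / m) ≤ Real.exp 1 * ρ * a) :
    ∃ D : ℕ → ℝ, Summable D ∧ (∀ m, 0 ≤ D m) ∧
      ∀ r, 0 < r → ∀ m, C m * r ^ m ≤ D m * Real.exp (b * r ^ ρ) := by
  have hb : 0 < b := ha.trans hab
  have hD0 : ∀ m : ℕ, 0 < (Real.exp 1 * ρ * b / m) ^ ((m : ℝ) / ρ) := by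
    intro m
    rcases Nat.eq_zero_or_pos m with rfl | hm
    · simp
    · have : (0 : ℝ) < m := by exact_mod_cast hm
      positivity
  refine ⟨fun m => C m / (Real.exp 1 * ρ * b / m) ^ ((m : ℝ) / ρ), ?_,
    fun m => div_nonneg (hC m) (hD0 m).le, fun r hr m => ?_⟩
  · have hq : (a / b) ^ (1 / ρ) < 1 :=
      Real.rpow_lt_one (by positivity) ((div_lt_one hb).mpr hab) (by positivity)
    refine Summable.of_norm_bounded_eventually_nat
      (summable_geometric_of_lt_one (by positivity) hq) ?_
    filter_upwards [h, eventually_gt_atTop 0] with m hm hm0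
    have hm0' : (0 : ℝ) < m := by exact_mod_cast hm0
    rw [Real.norm_of_nonneg (div_nonneg (hC m) (hD0 m).le), div_le_iff₀ (hD0 m)]
    have h1 : C m ^ (ρ / m) ≤ Real.exp 1 * ρ * a / m := by
      rw [le_div_iff₀ hm0']; linarith
    have h2 : (C m ^ (ρ / m)) ^ ((m : ℝ) / ρ) ≤ (Real.exp 1 * ρ * a / m) ^ ((m : ℝ) / ρ) :=
      Real.rpow_le_rpow (Real.rpow_nonneg (hC m) _) h1 (by positivity)
    have h3 : (C m ^ (ρ / m)) ^ ((m : ℝ) / ρ) = C m := by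
      rw [← Real.rpow_mul (hC m), div_mul_div_cancel₀ hm0'.ne', div_self hρ.ne', Real.rpow_one]
    rw [h3] at h2
    refine h2.trans_eq ?_
    rw [← Real.rpow_natCast, ← Real.rpow_mul (by positivity), one_div_mul_eq_div,
      ← Real.mul_rpow (by positivity) (by positivity)]
    congr 1
    field_simp
  · rw [div_mul_eq_mul_div, le_div_iff₀ (hD0 m), mul_assoc]
    refine mul_le_mul_of_nonneg_left ?_ (hC m)
    rcases Nat.eq_zero_or_pos m with rfl | hm
    · simp only [pow_zero, Nat.cast_zero, zero_div, Real.rpow_zero, mul_one]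
      exact Real.one_le_exp (by positivity)
    have hm0' : (0 : ℝ) < m := by exact_mod_cast hm
    have h1 : r ^ m = (r ^ ρ) ^ ((m : ℝ) / ρ) := by
      rw [← Real.rpow_mul hr.le, mul_div_cancel₀ _ hρ.ne', Real.rpow_natCast]
    rw [h1, ← Real.mul_rpow (by positivity) (by positivity)]
    have h2 := exp_one_mul_rpow_le (w := ρ * b * r ^ ρ / m) (y := (m : ℝ) / ρ)
      (by positivity) (by positivity)
    have h3 : ρ * b * r ^ ρ / m * ((m : ℝ) / ρ) = b * r ^ ρ := by field_simp
    have h4 : Real.exp 1 * ρ * b / m * r ^ ρ = Real.exp 1 * (ρ * b * r ^ ρ / m) := by ring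
    rw [mul_comm (r ^ ρ), h4, ← h3]
    exact h2

/-- The type of a function dominating the terms of a power series is nonnegative. -/
theorem zero_le_limsup_log_div_rpow (hC : ∀ m, 0 ≤ C m) (hρ : 0 < ρ)
    (hCM : ∀ r, 0 < r → ∀ m, C m * r ^ m ≤ M r) (hM0 : (∀ m, C m = 0) → ∀ r, 0 < r → M r = 0) :
    0 ≤ limsup (fun r : ℝ => ((Real.log (M r) / r ^ ρ : ℝ) : EReal)) atTop := by
  by_cases h0 : ∀ m, C m = 0
  · refine le_limsup_of_frequently_le' (Eventually.frequently ?_)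
    filter_upwards [eventually_gt_atTop 0] with r hr
    simp [hM0 h0 r hr]
  · push Not at h0
    obtain ⟨m, hm⟩ := h0
    have hm : 0 < C m := lt_of_le_of_ne (hC m) (Ne.symm hm)
    have htend : Tendsto (fun r : ℝ => ((Real.log (C m) / r ^ ρ : ℝ) : EReal)) atTop
        (nhds ((0 : ℝ) : EReal)) :=
      (continuous_coe_real_ereal.tendsto _).comp
        (tendsto_const_nhds.div_atTop (tendsto_rpow_atTop hρ))
    rw [← EReal.coe_zero, ← htend.limsup_eq]
    refine limsup_le_limsup ?_
    filter_upwards [eventually_ge_atTop 1] with r hr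
    have hr0 : 0 < r := by linarith
    have hle : C m ≤ M r := (le_mul_of_one_le_right hm.le (one_le_pow₀ hr)).trans (hCM r hr0 m)
    exact EReal.coe_le_coe_iff.mpr
      (div_le_div_of_nonneg_right (Real.log_le_log hm hle) (by positivity))

theorem limsup_log_div_rpow_le (hρ : 0 < ρ) {A : ℝ} (hA : 1 ≤ A) (hb : 0 ≤ b)
    (hM0 : ∀ r, 0 ≤ M r) (hM : ∀ r, 0 < r → M r ≤ A * Real.exp (b * r ^ ρ)) :
    limsup (fun r : ℝ => ((Real.log (M r) / r ^ ρ : ℝ) : EReal)) atTop ≤ (b : EReal) := by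
  have htend : Tendsto (fun r : ℝ => ((Real.log A / r ^ ρ + b : ℝ) : EReal)) atTop
      (nhds ((0 + b : ℝ) : EReal)) :=
    (continuous_coe_real_ereal.tendsto _).comp
      ((tendsto_const_nhds.div_atTop (tendsto_rpow_atTop hρ)).add tendsto_const_nhds)
  rw [zero_add] at htend
  rw [← htend.limsup_eq]
  refine limsup_le_limsup ?_
  filter_upwards [eventually_gt_atTop 0] with r hr
  refine EReal.coe_le_coe_iff.mpr ?_
  have hrρ : 0 < r ^ ρ := by positivity
  rw [div_le_iff₀ hrρ, add_mul, div_mul_cancel₀ _ hrρ.ne']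
  have hlogA := Real.log_nonneg hA
  rcases (hM0 r).eq_or_lt with h0 | h0
  · rw [← h0, Real.log_zero]
    positivity
  · calc Real.log (M r) ≤ Real.log (A * Real.exp (b * r ^ ρ)) := Real.log_le_log h0 (hM r hr)
      _ = Real.log A + b * r ^ ρ := by
        rw [Real.log_mul (by positivity) (Real.exp_ne_zero _), Real.log_exp]

/-- The coefficient formula for the type, for a function `M` squeezed between the terms and the
sum of a power series with nonnegative coefficients. -/
theorem limsup_mul_rpow_eq_mul_limsup_log_div_rpow (hC : ∀ m, 0 ≤ C m) (hρ : 0 < ρ)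
    (hM0 : ∀ r, 0 ≤ M r) (hCM : ∀ r, 0 < r → ∀ m, C m * r ^ m ≤ M r)
    (hMC : ∀ r, 0 < r → Summable (fun m => C m * r ^ m) → M r ≤ ∑' m, C m * r ^ m) :
    limsup (fun m : ℕ => (((m : ℝ) * C m ^ (ρ / (m : ℝ)) : ℝ) : EReal)) atTop
      = ((Real.exp 1 * ρ : ℝ) : EReal) *
        limsup (fun r : ℝ => ((Real.log (M r) / r ^ ρ : ℝ) : EReal)) atTop := by
  have hc : 0 < Real.exp 1 * ρ := by positivity
  have hcE : (0 : EReal) < ((Real.exp 1 * ρ : ℝ) : EReal) := EReal.coe_pos.mpr hc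
  have hτ0 := zero_le_limsup_log_div_rpow (M := M) hC hρ hCM fun h0 r hr =>
    le_antisymm (by simpa [h0, summable_zero] using hMC r hr) (hM0 r)
  set τ := limsup (fun r : ℝ => ((Real.log (M r) / r ^ ρ : ℝ) : EReal)) atTop with hτ
  apply le_antisymm
  · rw [← EReal.le_of_forall_lt_iff_le]
    intro z hz
    have hz0 : 0 < z := EReal.coe_pos.mp ((mul_nonneg hcE.le hτ0).trans_lt hz)
    have hτz : τ < ((z / (Real.exp 1 * ρ) : ℝ) : EReal) := by
      rw [EReal.coe_div, EReal.lt_div_iff hcE (EReal.coe_ne_top _), mul_comm]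
      exact hz
    have hM : ∀ᶠ r in atTop, Real.log (M r) ≤ z / (Real.exp 1 * ρ) * r ^ ρ := by
      filter_upwards [eventually_lt_of_limsup_lt hτz, eventually_gt_atTop 0] with r h1 hr
      exact (div_le_iff₀ (by positivity)).mp (EReal.coe_lt_coe_iff.mp h1).le
    refine limsup_le_of_le (h := ?_)
    filter_upwards [eventually_mul_rpow_le_of_growth hC hρ (by positivity) hCM hM] with m hm
    rw [mul_div_cancel₀ _ hc.ne'] at hm
    exact EReal.coe_le_coe_iff.mpr hm
  · rw [← EReal.le_of_forall_lt_iff_le]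
    intro z hz
    have hv0 : 0 ≤ limsup (fun m : ℕ => (((m : ℝ) * C m ^ (ρ / (m : ℝ)) : ℝ) : EReal)) atTop :=
      le_limsup_of_frequently_le' (Frequently.of_forall fun m => EReal.coe_nonneg.mpr
        (mul_nonneg m.cast_nonneg (Real.rpow_nonneg (hC m) _)))
    have hz0 : 0 < z := EReal.coe_pos.mp (hv0.trans_lt hz)
    set a := z / (Real.exp 1 * ρ) with ha
    have ha0 : 0 < a := by positivity
    have hca : Real.exp 1 * ρ * a = z := mul_div_cancel₀ _ hc.ne'
    have hCa : ∀ᶠ m : ℕ in atTop, (m : ℝ) * C m ^ (ρ / m) ≤ Real.exp 1 * ρ * a := by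
      filter_upwards [eventually_lt_of_limsup_lt hz] with m hm
      rw [hca]
      exact (EReal.coe_lt_coe_iff.mp hm).le
    have hτa : τ ≤ (a : EReal) := by
      rw [← EReal.le_of_forall_lt_iff_le]
      intro b hab
      have hab : a < b := EReal.coe_lt_coe_iff.mp hab
      obtain ⟨D, hD, hD0, hDC⟩ := exists_summable_mul_pow_le_exp hC hρ ha0 hab hCa
      refine limsup_log_div_rpow_le hρ (A := 1 + ∑' m, D m)
        (le_add_of_nonneg_right (tsum_nonneg hD0)) (ha0.trans hab).le hM0 fun r hr => ?_
      have hs : Summable fun m => C m * r ^ m :=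
        Summable.of_nonneg_of_le (fun m => mul_nonneg (hC m) (by positivity)) (hDC r hr)
          (hD.mul_right _)
      calc M r ≤ ∑' m, C m * r ^ m := hMC r hr hs
        _ ≤ ∑' m, D m * Real.exp (b * r ^ ρ) := hs.tsum_le_tsum (hDC r hr) (hD.mul_right _)
        _ = (∑' m, D m) * Real.exp (b * r ^ ρ) := tsum_mul_right
        _ ≤ (1 + ∑' m, D m) * Real.exp (b * r ^ ρ) := by gcongr; linarith
    calc ((Real.exp 1 * ρ : ℝ) : EReal) * τ ≤ ((Real.exp 1 * ρ : ℝ) : EReal) * (a : EReal) :=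
          mul_le_mul_of_nonneg_left hτa hcE.le
      _ = (z : EReal) := by rw [← EReal.coe_mul, hca]

end Growth

/-- For an entire function of order `ρ ∈ (0,∞)` and type `τ`, with homogeneous expansion
`F = ∑ f_m`, one has `limsup m · (max_{|z|=1} |f_m(z)|)^{ρ/m} = e ρ τ`. -/
theorem limsup_homogeneous_expansion_eq_order_type
    (n : ℕ) (hn : 1 ≤ n) (F : EuclideanSpace ℂ (Fin n) → ℂ) (hF : Differentiable ℂ F)
    (ρ : ℝ) (hρ0 : 0 < ρ) (hρ : entireOrder n F = (ρ : EReal))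
    (τ : EReal) (hτ : entireType n F ρ = τ)
    (fm : ℕ → MvPolynomial (Fin n) ℂ) (hhom : ∀ m, (fm m).IsHomogeneous m)
    (hsum : ∀ z : EuclideanSpace ℂ (Fin n),
      HasSum (fun m => eval (z : Fin n → ℂ) (fm m)) (F z)) :
    limsup (fun m : ℕ =>
        (((m : ℝ) * (sphereMaxC n (fm m)) ^ (ρ / (m : ℝ)) : ℝ) : EReal)) atTop
      = ((Real.exp 1 : ℝ) : EReal) * ((ρ : ℝ) : EReal) * τ := by
  rw [← hτ, ← EReal.coe_mul]
  have hC : ∀ m, 0 ≤ sphereMaxC n (fm m) := fun m => iSup_sphere_norm_nonneg _ _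
  refine limsup_mul_rpow_eq_mul_limsup_log_div_rpow hC hρ0
    (fun r => iSup_sphere_norm_nonneg F r)
    (fun r hr m => sphereMaxC_mul_pow_le_Mf hF.continuous hhom hsum hr m) fun r hr hs => ?_
  exact iSup_sphere_norm_le (tsum_nonneg fun m => mul_nonneg (hC m) (by positivity))
    fun z hz => (hsum z).norm_le_of_bounded hs.hasSum
      fun m => norm_eval_le_sphereMaxC_mul_pow (hhom m) hr hz
end

section
/- There exists a constant C_n, depending only on the dimension n, with the following property: for every harmonic polynomial v on ℝ^n with decomposition v = v_0 + v_1 + … + v_m into homogeneous polynomials v_k of degree k, and for every k with 1 ≤ k ≤ m, one has max_{θ ∈ S^{n-1}} |v_k(θ)| ≤ C_n · k^{n/2} · max_{θ ∈ S^{n-1}} |v(θ)|. -/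
open MvPolynomial Filter

/-- The Laplacian of a polynomial: `Δp = ∑ ∂²p/∂x_i²`. -/
noncomputable def polyLap {n : ℕ} (p : MvPolynomial (Fin n) ℝ) : MvPolynomial (Fin n) ℝ :=
  ∑ i, pderiv i (pderiv i p)

namespace HarmonicPolynomial

open MeasureTheory

variable {n : ℕ}

/-! ### Algebra of the Laplacian -/

lemma polyLap_add (p q : MvPolynomial (Fin n) ℝ) : polyLap (p + q) = polyLap p + polyLap q := by
  simp [polyLap, Finset.sum_add_distrib]

lemma polyLap_C_mul (c : ℝ) (p : MvPolynomial (Fin n) ℝ) :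
    polyLap (C c * p) = C c * polyLap p := by
  simp only [polyLap, pderiv_C_mul, Finset.mul_sum]

lemma pderiv_homogeneousComponent_succ (i : Fin n) (k : ℕ) (p : MvPolynomial (Fin n) ℝ) :
    pderiv i (homogeneousComponent (k + 1) p) = homogeneousComponent k (pderiv i p) := by
  ext d
  simp only [coeff_pderiv, coeff_homogeneousComponent]
  have : (d + Finsupp.single i 1).degree = d.degree + 1 := by simp
  simp [this]

lemma polyLap_homogeneousComponent {p : MvPolynomial (Fin n) ℝ} (hp : polyLap p = 0) (k : ℕ) :
    polyLap (homogeneousComponent k p) = 0 := by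
  match k with
  | 0 => simp [polyLap]
  | 1 => simp [polyLap, pderiv_homogeneousComponent_succ]
  | k + 2 =>
    have h : polyLap (homogeneousComponent (k + 2) p) = homogeneousComponent k (polyLap p) := by
      simp [polyLap, pderiv_homogeneousComponent_succ]
    rw [h, hp, map_zero]

lemma pderiv_sum_X_sq (i : Fin n) :
    pderiv i (∑ j, X j ^ 2 : MvPolynomial (Fin n) ℝ) = C 2 * X i := by
  rw [map_sum, Finset.sum_eq_single i]
  · simp [map_ofNat C 2]
  · intro j _ hj; simp [pderiv_X_of_ne hj]
  · simp

/-- The polynomial `y ↦ p (a + y)`. -/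
noncomputable def translate (a : Fin n → ℝ) :
    MvPolynomial (Fin n) ℝ →ₐ[ℝ] MvPolynomial (Fin n) ℝ :=
  aeval fun i => C (a i) + X i

lemma eval_translate (a y : Fin n → ℝ) (p : MvPolynomial (Fin n) ℝ) :
    eval y (translate a p) = eval (a + y) p := by
  induction p using MvPolynomial.induction_on with
  | C c => simp [translate]
  | add p q hp hq => simp [hp, hq]
  | mul_X p i hp => rw [map_mul, map_mul, hp]; simp [translate]

lemma pderiv_translate (a : Fin n → ℝ) (i : Fin n) (p : MvPolynomial (Fin n) ℝ) :
    pderiv i (translate a p) = translate a (pderiv i p) := by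
  induction p using MvPolynomial.induction_on with
  | C c => simp [translate]
  | add p q hp hq => simp [hp, hq]
  | mul_X p j hp =>
    rw [map_mul, pderiv_mul, hp, pderiv_mul, map_add, map_mul, map_mul]
    congr 2
    rcases eq_or_ne j i with rfl | h
    · simp [translate]
    · simp [translate, pderiv_X_of_ne h]

lemma polyLap_translate (a : Fin n → ℝ) (p : MvPolynomial (Fin n) ℝ) :
    polyLap (translate a p) = translate a (polyLap p) := by
  simp [polyLap, pderiv_translate]

lemma eval_smul_of_isHomogeneous {p : MvPolynomial (Fin n) ℝ} {k : ℕ} (hp : p.IsHomogeneous k)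
    (c : ℝ) (x : Fin n → ℝ) : eval (c • x) p = c ^ k * eval x p := by
  rw [eval_eq, eval_eq, Finset.mul_sum]
  refine Finset.sum_congr rfl fun d hd => ?_
  have hdeg : ∑ i ∈ d.support, d i = k := by
    have := hp (mem_support_iff.mp hd)
    rwa [show Finsupp.weight (1 : Fin n → ℕ) d = d.degree from
      (DFunLike.congr_fun Finsupp.degree_eq_weight_one d).symm, Finsupp.degree_apply] at this
  simp only [Pi.smul_apply, smul_eq_mul, mul_pow, Finset.prod_mul_distrib]
  rw [Finset.prod_pow_eq_pow_sum, hdeg]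
  ring

/-! ### Calculus of polynomials -/

lemma hasDerivAt_eval_line (p : MvPolynomial (Fin n) ℝ) (i : Fin n) (x : Fin n → ℝ) (t : ℝ) :
    HasDerivAt (fun t : ℝ => eval (x + t • Pi.single i 1) p)
      (eval (x + t • Pi.single i 1) (pderiv i p)) t := by
  induction p using MvPolynomial.induction_on with
  | C c => simpa using hasDerivAt_const t c
  | add p q hp hq => simpa only [map_add] using hp.fun_add hq
  | mul_X p j hp =>
    have hX : HasDerivAt (fun t : ℝ => eval (x + t • Pi.single i 1) (X j : MvPolynomial (Fin n) ℝ))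
        (eval (x + t • Pi.single i 1) (pderiv i (X j : MvPolynomial (Fin n) ℝ))) t := by
      rcases eq_or_ne j i with rfl | h
      · simpa using (hasDerivAt_id t).const_add (x j)
      · simpa [pderiv_X_of_ne h, h] using hasDerivAt_const t (x j)
    simpa only [pderiv_mul, map_add, map_mul] using hp.fun_mul hX

/-- The squared Euclidean norm on `Fin n → ℝ`. -/
def normSq (x : Fin n → ℝ) : ℝ := ∑ i, x i ^ 2

lemma continuous_normSq : Continuous (normSq : (Fin n → ℝ) → ℝ) := by
  unfold normSq; fun_prop

lemma normSq_nonneg (x : Fin n → ℝ) : 0 ≤ normSq x := Finset.sum_nonneg fun _ _ => sq_nonneg _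

lemma normSq_smul (c : ℝ) (x : Fin n → ℝ) : normSq (c • x) = c ^ 2 * normSq x := by
  simp [normSq, mul_pow, Finset.mul_sum]

lemma normSq_eq_norm_sq (x : EuclideanSpace ℝ (Fin n)) : normSq (x : Fin n → ℝ) = ‖x‖ ^ 2 := by
  rw [EuclideanSpace.norm_sq_eq]; simp [normSq]

lemma sqrt_normSq_add_le (x y : Fin n → ℝ) :
    √(normSq (x + y)) ≤ √(normSq x) + √(normSq y) := by
  have h (z : Fin n → ℝ) : √(normSq z) = ‖WithLp.toLp 2 z‖ := by
    rw [← Real.sqrt_sq (norm_nonneg (WithLp.toLp 2 z)), ← normSq_eq_norm_sq]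
  simpa only [h, WithLp.toLp_add] using norm_add_le (WithLp.toLp 2 x) (WithLp.toLp 2 y)

lemma isCompact_normSq_le (s : ℝ) : IsCompact {x : Fin n → ℝ | normSq x ≤ s} := by
  refine Metric.isCompact_of_isClosed_isBounded
    (isClosed_le continuous_normSq continuous_const) ?_
  refine (Metric.isBounded_closedBall (x := (0 : Fin n → ℝ)) (r := √s)).subset fun x hx => ?_
  rw [mem_closedBall_zero_iff, pi_norm_le_iff_of_nonneg (Real.sqrt_nonneg s)]
  intro i
  refine Real.le_sqrt_of_sq_le ?_
  rw [Real.norm_eq_abs, sq_abs]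
  exact (Finset.single_le_sum (f := fun i => x i ^ 2) (fun j _ => sq_nonneg _)
    (Finset.mem_univ i)).trans hx

/-! ### The maximum principle -/

/-- At a local maximum of a polynomial the second partial derivatives are nonpositive. -/
lemma eval_pderiv_pderiv_nonpos_of_isLocalMax {p : MvPolynomial (Fin n) ℝ} {x : Fin n → ℝ}
    (h : IsLocalMax (fun y => eval y p) x) (i : Fin n) :
    eval x (pderiv i (pderiv i p)) ≤ 0 := by
  by_contra! hpos
  set f : ℝ → ℝ := fun t => eval (x + t • Pi.single i 1) p with hf
  have hd : deriv f = fun t => eval (x + t • Pi.single i 1) (pderiv i p) :=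
    funext fun t => (hasDerivAt_eval_line p i x t).deriv
  have hdd : deriv (deriv f) 0 = eval x (pderiv i (pderiv i p)) := by
    rw [hd, (hasDerivAt_eval_line (pderiv i p) i x 0).deriv]; simp
  have hcont : Continuous fun t : ℝ => x + t • (Pi.single i 1 : Fin n → ℝ) := by fun_prop
  have hmax : IsLocalMax f 0 := by
    have ht : Tendsto (fun t : ℝ => x + t • (Pi.single i 1 : Fin n → ℝ)) (nhds 0) (nhds x) := by
      simpa using hcont.tendsto 0
    filter_upwards [ht.eventually h] with t ht
    simpa [hf] using ht
  have hmin : IsLocalMin f 0 := isLocalMin_of_deriv_deriv_pos (by rw [hdd]; exact hpos)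
    hmax.deriv_eq_zero (hasDerivAt_eval_line p i x 0).continuousAt
  have hconst : f =ᶠ[nhds 0] fun _ => f 0 := by
    filter_upwards [hmax, hmin] with t h1 h2 using le_antisymm h1 h2
  have : deriv (deriv f) 0 = 0 := by
    rw [hconst.deriv.deriv_eq]; simp
  linarith [hdd]

lemma eval_le_of_forall_sphere (hn : 1 ≤ n) {p : MvPolynomial (Fin n) ℝ} (hp : polyLap p = 0)
    {M : ℝ} (hM : ∀ x, normSq x = 1 → eval x p ≤ M) {x : Fin n → ℝ} (hx : normSq x ≤ 1) :
    eval x p ≤ M := by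
  refine le_of_forall_pos_le_add fun ε hε => ?_
  set R : MvPolynomial (Fin n) ℝ := ∑ i, X i ^ 2 with hR
  have hRe (y : Fin n → ℝ) : eval y R = normSq y := by simp [hR, normSq]
  have hLR : polyLap R = C (2 * n : ℝ) := by
    simp only [polyLap, hR, pderiv_sum_X_sq, pderiv_C_mul, pderiv_X_self]
    simp [mul_comm]
  set u := p + C ε * R with hu
  have hLu : polyLap u = C (ε * (2 * n)) := by
    rw [hu, polyLap_add, polyLap_C_mul, hp, hLR, zero_add, ← C_mul]
  obtain ⟨z, hz, hzmax⟩ := (isCompact_normSq_le (n := n) 1).exists_isMaxOn ⟨x, hx⟩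
    (MvPolynomial.continuous_eval u).continuousOn
  have hue (y : Fin n → ℝ) : eval y u = eval y p + ε * normSq y := by
    simp [hu, hRe]
  have hz1 : normSq z = 1 := by
    by_contra hne
    have hlt : normSq z < 1 := lt_of_le_of_ne hz hne
    have hloc : IsLocalMax (fun y => eval y u) z := by
      filter_upwards [(isOpen_lt continuous_normSq continuous_const).mem_nhds hlt] with y hy
      exact hzmax (le_of_lt hy)
    have h1 : eval z (polyLap u) ≤ 0 := by
      simp only [polyLap, map_sum]
      exact Finset.sum_nonpos fun i _ => eval_pderiv_pderiv_nonpos_of_isLocalMax hloc i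
    rw [hLu, eval_C] at h1
    have : (0 : ℝ) < n := by exact_mod_cast hn
    have : 0 < ε * (2 * n) := by positivity
    linarith
  have h1 : eval x u ≤ eval z u := hzmax hx
  rw [hue, hue, hz1] at h1
  nlinarith [hM z hz1, normSq_nonneg x]

lemma abs_eval_le_of_forall_sphere (hn : 1 ≤ n) {p : MvPolynomial (Fin n) ℝ}
    (hp : polyLap p = 0) {M : ℝ} (hM : ∀ x, normSq x = 1 → |eval x p| ≤ M) {x : Fin n → ℝ}
    (hx : normSq x ≤ 1) : |eval x p| ≤ M := by
  refine abs_le'.mpr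
    ⟨eval_le_of_forall_sphere hn hp (fun y hy => (le_abs_self _).trans (hM y hy)) hx, ?_⟩
  have hneg : polyLap (C (-1) * p) = 0 := by rw [polyLap_C_mul, hp, mul_zero]
  simpa using eval_le_of_forall_sphere hn hneg (M := M)
    (fun y hy => by simpa using (neg_le_abs _).trans (hM y hy)) hx

/-! ### Radial weights -/

/-- The radial weight `(s - |x|²)₊`. -/
def tent (s : ℝ) (x : Fin n → ℝ) : ℝ := max 0 (s - normSq x)

lemma continuous_tent (s : ℝ) : Continuous (tent s : (Fin n → ℝ) → ℝ) :=
  continuous_const.max (continuous_const.sub continuous_normSq)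

lemma tent_nonneg (s : ℝ) (x : Fin n → ℝ) : 0 ≤ tent s x := le_max_left _ _

lemma tent_eq_zero {s : ℝ} {x : Fin n → ℝ} (h : s ≤ normSq x) : tent s x = 0 :=
  max_eq_left (by linarith)

lemma tent_eq_sub {s : ℝ} {x : Fin n → ℝ} (h : normSq x ≤ s) : tent s x = s - normSq x :=
  max_eq_right (by linarith)

lemma hasCompactSupport_tent (s : ℝ) : HasCompactSupport (tent s : (Fin n → ℝ) → ℝ) :=
  HasCompactSupport.intro (isCompact_normSq_le s) fun _ hx => tent_eq_zero (not_le.mp hx).le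

lemma integrable_tent (s : ℝ) : Integrable (tent s : (Fin n → ℝ) → ℝ) :=
  (continuous_tent s).integrable_of_hasCompactSupport (hasCompactSupport_tent s)

lemma tent_smul (δ : ℝ) (x : Fin n → ℝ) :
    tent (δ ^ 2) (δ • x) = δ ^ 2 * tent 1 x := by
  rw [tent, tent, normSq_smul, mul_max_of_nonneg _ _ (sq_nonneg δ)]
  ring_nf

lemma integral_tent_one_pos : 0 < ∫ x : Fin n → ℝ, tent 1 x :=
  (continuous_tent 1).integral_pos_of_hasCompactSupport_nonneg_nonzero (hasCompactSupport_tent 1)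
    (tent_nonneg 1) (x := 0) (by simp [tent, normSq])

lemma integral_tent_sq {δ : ℝ} (hδ : 0 < δ) :
    ∫ x : Fin n → ℝ, tent (δ ^ 2) x = δ ^ 2 * δ ^ n * ∫ x : Fin n → ℝ, tent 1 x := by
  have h := Measure.integral_comp_smul (volume : Measure (Fin n → ℝ)) (tent (δ ^ 2)) δ
  simp only [tent_smul, integral_const_mul, Module.finrank_fin_fun, smul_eq_mul] at h
  rw [abs_of_pos (by positivity)] at h
  rw [mul_right_comm, h]
  field_simp

lemma integrable_eval_mul (p : MvPolynomial (Fin n) ℝ) {w : (Fin n → ℝ) → ℝ} (hw : Continuous w)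
    (hs : HasCompactSupport w) : Integrable fun x => eval x p * w x :=
  ((MvPolynomial.continuous_eval p).mul hw).integrable_of_hasCompactSupport hs.mul_left

lemma integrable_eval_mul_tent (p : MvPolynomial (Fin n) ℝ) (s : ℝ) :
    Integrable fun x => eval x p * tent s x :=
  integrable_eval_mul p (continuous_tent s) (hasCompactSupport_tent s)

lemma integrable_eval_mul_tent_sq (p : MvPolynomial (Fin n) ℝ) (s : ℝ) :
    Integrable fun x => eval x p * tent s x ^ 2 :=
  integrable_eval_mul p ((continuous_tent s).pow 2) <| by
    simp only [sq]; exact (hasCompactSupport_tent s).mul_left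

lemma hasDerivAt_max_zero_sq (t : ℝ) : HasDerivAt (fun t : ℝ => max 0 t ^ 2) (2 * max 0 t) t := by
  rcases lt_trichotomy t 0 with h | rfl | h
  · rw [max_eq_left h.le, mul_zero]
    refine (hasDerivAt_const t (0 : ℝ)).congr_of_eventuallyEq ?_
    filter_upwards [gt_mem_nhds h] with s hs
    simp [max_eq_left (le_of_lt hs)]
  · rw [max_self, mul_zero, hasDerivAt_iff_isLittleO_nhds_zero]
    refine Asymptotics.IsBigO.trans_isLittleO (g := fun h : ℝ => h ^ 2) ?_ ?_
    · refine Asymptotics.IsBigO.of_bound 1 (Eventually.of_forall fun s => ?_)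
      rcases le_total s 0 with hs | hs <;> simp [hs, sq_nonneg]
    · simpa using Asymptotics.isLittleO_pow_id (𝕜 := ℝ) one_lt_two
  · rw [max_eq_right h.le]
    refine HasDerivAt.congr_of_eventuallyEq (by simpa using hasDerivAt_pow 2 t) ?_
    filter_upwards [lt_mem_nhds h] with s hs
    simp [max_eq_right (le_of_lt hs)]

lemma hasLineDerivAt_tent_sq (s : ℝ) (i : Fin n) (x : Fin n → ℝ) :
    HasLineDerivAt ℝ (fun x => tent s x ^ 2) (-4 * (x i * tent s x)) x (Pi.single i 1) := by
  have hq : HasDerivAt (fun t : ℝ => s - normSq (x + t • Pi.single i (1 : ℝ))) (-(2 * x i)) 0 := by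
    refine HasDerivAt.const_sub s ?_
    have h := hasDerivAt_eval_line (∑ j, X j ^ 2 : MvPolynomial (Fin n) ℝ) i x 0
    rw [pderiv_sum_X_sq] at h
    simpa [normSq] using h
  have h := HasDerivAt.comp (0 : ℝ) (hasDerivAt_max_zero_sq _) hq
  have hval : 2 * max 0 (s - normSq (x + (0 : ℝ) • Pi.single i (1 : ℝ))) * -(2 * x i)
      = -4 * (x i * tent s x) := by
    simp only [zero_smul, add_zero, tent]; ring
  rwa [hval] at h

lemma integral_pderiv_mul_tent_sq (p : MvPolynomial (Fin n) ℝ) (s : ℝ) (i : Fin n) :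
    ∫ x, eval x (pderiv i p) * tent s x ^ 2 = 4 * ∫ x, eval x (X i * p) * tent s x := by
  have hg (x : Fin n → ℝ) :
      eval x p * (-4 * (x i * tent s x)) = -4 * (eval x (X i * p) * tent s x) := by
    simp; ring
  have h := integral_bilinear_hasLineDerivAt_right_eq_neg_left_of_integrable (μ := volume)
    (B := ContinuousLinearMap.mul ℝ ℝ) (v := Pi.single i 1)
    (f := fun x => eval x p) (f' := fun x => eval x (pderiv i p))
    (g := fun x => tent s x ^ 2) (g' := fun x => -4 * (x i * tent s x)) (integrable_eval_mul_tent_sq _ s)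
    (by
      simp only [ContinuousLinearMap.mul_apply', hg]
      exact (integrable_eval_mul_tent _ s).const_mul _)
    (integrable_eval_mul_tent_sq _ s)
    (fun x _ => by simpa [HasLineDerivAt] using hasDerivAt_eval_line p i x 0)
    (fun x _ => hasLineDerivAt_tent_sq s i x)
  simp only [ContinuousLinearMap.mul_apply', hg, integral_const_mul] at h
  linarith

/-- Harmonic homogeneous polynomials of different degrees are orthogonal for the weights `tent`. -/
lemma integral_mul_tent_eq_zero {p q : MvPolynomial (Fin n) ℝ} {a b : ℕ}
    (hp : p.IsHomogeneous a) (hq : q.IsHomogeneous b) (hLp : polyLap p = 0) (hLq : polyLap q = 0)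
    (hab : a ≠ b) (s : ℝ) : ∫ x, eval x (p * q) * tent s x = 0 := by
  have hdiv : ∑ i, pderiv i (p * pderiv i q - q * pderiv i p) = 0 := by
    have : ∀ i, pderiv i (p * pderiv i q - q * pderiv i p)
        = p * pderiv i (pderiv i q) - q * pderiv i (pderiv i p) := fun i => by
      rw [map_sub, pderiv_mul, pderiv_mul]; ring
    simp only [this, Finset.sum_sub_distrib, ← Finset.mul_sum]
    unfold polyLap at hLp hLq
    rw [hLp, hLq]; ring
  have hrad : ∑ i, X i * (p * pderiv i q - q * pderiv i p) = C ((b : ℝ) - a) * (p * q) := by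
    have : ∀ i, X i * (p * pderiv i q - q * pderiv i p)
        = p * (X i * pderiv i q) - q * (X i * pderiv i p) := fun i => by ring
    simp only [this, Finset.sum_sub_distrib, ← Finset.mul_sum, hp.sum_X_mul_pderiv,
      hq.sum_X_mul_pderiv]
    simp; ring
  have h1 : ∑ i, ∫ x, eval x (pderiv i (p * pderiv i q - q * pderiv i p)) * tent s x ^ 2 = 0 := by
    rw [← integral_finsetSum _ fun i _ => integrable_eval_mul_tent_sq _ s]
    simp only [← Finset.sum_mul, ← map_sum, hdiv]
    simp
  simp only [integral_pderiv_mul_tent_sq, ← Finset.mul_sum] at h1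
  rw [← integral_finsetSum _ fun i _ => integrable_eval_mul_tent _ s] at h1
  simp only [← Finset.sum_mul, ← map_sum, hrad] at h1
  simp only [map_mul, eval_C, mul_assoc, integral_const_mul] at h1
  have hne : (b : ℝ) - a ≠ 0 := sub_ne_zero.mpr (by exact_mod_cast hab.symm)
  simpa [hne, mul_assoc] using h1

/-- The mean value property for the weights `tent`. -/
lemma integral_eval_mul_tent {p : MvPolynomial (Fin n) ℝ} (hp : polyLap p = 0) (s : ℝ) :
    ∫ x, eval x p * tent s x = eval 0 p * ∫ x : Fin n → ℝ, tent s x := by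
  have h (j : ℕ) (hj : j ≠ 0) : ∫ x, eval x (homogeneousComponent j p) * tent s x = 0 := by
    simpa using integral_mul_tent_eq_zero (homogeneousComponent_isHomogeneous j p)
      (isHomogeneous_one _ _) (polyLap_homogeneousComponent hp j) (by simp [polyLap]) hj s
  conv_lhs => rw [← sum_homogeneousComponent p]
  simp only [map_sum, Finset.sum_mul]
  rw [integral_finsetSum _ fun i _ => integrable_eval_mul_tent _ s,
    Finset.sum_eq_single 0 (fun j _ hj => h j hj) (by simp), homogeneousComponent_zero]
  simp [integral_const_mul, constantCoeff_eq]

lemma sq_eval_mul_integral_tent_le {p : MvPolynomial (Fin n) ℝ} (hp : polyLap p = 0)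
    (a : Fin n → ℝ) (s : ℝ) :
    eval a p ^ 2 * ∫ x : Fin n → ℝ, tent s x ≤ ∫ x, eval (a + x) p ^ 2 * tent s x := by
  set q := translate a p with hq
  have hLq : polyLap q = 0 := by rw [hq, polyLap_translate, hp, map_zero]
  have hmv := integral_eval_mul_tent hLq s
  have h0 : eval 0 q = eval a p := by rw [hq, eval_translate, add_zero]
  have hnn : 0 ≤ ∫ x, eval x ((q - C (eval a p)) ^ 2) * tent s x :=
    integral_nonneg fun x => mul_nonneg (by simpa using sq_nonneg _) (tent_nonneg s x)
  have hexp : ∀ x, eval x ((q - C (eval a p)) ^ 2) * tent s x = eval x (q ^ 2) * tent s x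
      - 2 * eval a p * (eval x q * tent s x) + eval a p ^ 2 * tent s x := fun x => by
    simp; ring
  simp only [hexp] at hnn
  have hI (r : MvPolynomial (Fin n) ℝ) := integrable_eval_mul_tent r s
  rw [integral_add ?_ ((integrable_tent s).const_mul _), integral_sub (hI _) ((hI _).const_mul _),
    integral_const_mul, integral_const_mul, hmv, h0] at hnn
  swap
  · exact (hI _).sub ((hI _).const_mul _)
  have : ∀ x, eval x (q ^ 2) = eval (a + x) p ^ 2 := fun x => by rw [map_pow, hq, eval_translate]
  simp only [this] at hnn
  linarith

/-- Each homogeneous component of a harmonic polynomial has a smaller `L²` norm than the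
polynomial, for the weight `(1 - |x|²)₊ - (t - |x|²)₊`. -/
lemma integral_sq_homogeneousComponent_le {v : MvPolynomial (Fin n) ℝ} (hv : polyLap v = 0)
    (k : ℕ) {t : ℝ} (ht : t ≤ 1) :
    ∫ x, eval x (homogeneousComponent k v ^ 2) * (tent 1 x - tent t x) ≤
      ∫ x, eval x (v ^ 2) * (tent 1 x - tent t x) := by
  set p := homogeneousComponent k v with hp
  have hI (q : MvPolynomial (Fin n) ℝ) :
      Integrable fun x => eval x q * (tent 1 x - tent t x) := by
    simp only [mul_sub]
    exact (integrable_eval_mul_tent q 1).sub (integrable_eval_mul_tent q t)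
  have horth (s : ℝ) : ∫ x, eval x (p * (v - p)) * tent s x = 0 := by
    have hj (j : ℕ) (hjk : j ≠ k) :
        ∫ x, eval x (p * homogeneousComponent j v) * tent s x = 0 :=
      integral_mul_tent_eq_zero (homogeneousComponent_isHomogeneous k v)
        (homogeneousComponent_isHomogeneous j v) (polyLap_homogeneousComponent hv k)
        (polyLap_homogeneousComponent hv j) hjk.symm s
    have hsum : p * (v - p) =
        ∑ j ∈ (Finset.range (v.totalDegree + 1)).erase k, p * homogeneousComponent j v := by
      rw [← Finset.mul_sum]
      congr 1
      by_cases hk : k ∈ Finset.range (v.totalDegree + 1)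
      · rw [sub_eq_iff_eq_add, Finset.sum_erase_add _ _ hk, sum_homogeneousComponent]
      · rw [Finset.erase_eq_of_notMem hk, sum_homogeneousComponent, hp,
          homogeneousComponent_eq_zero _ _ (by simpa [Nat.lt_succ_iff] using hk), sub_zero]
    rw [hsum]
    simp only [map_sum, Finset.sum_mul]
    rw [integral_finsetSum _ fun i _ => integrable_eval_mul_tent _ s]
    exact Finset.sum_eq_zero fun j hjm => hj j (Finset.ne_of_mem_erase hjm)
  have hcross : ∫ x, eval x (p * (v - p)) * (tent 1 x - tent t x) = 0 := by
    simp only [mul_sub _ (tent 1 _)]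
    rw [integral_sub (integrable_eval_mul_tent _ 1) (integrable_eval_mul_tent _ t), horth, horth,
      sub_zero]
  have hexp : ∀ x, eval x (v ^ 2) * (tent 1 x - tent t x) =
      eval x (p ^ 2) * (tent 1 x - tent t x) +
        (2 * (eval x (p * (v - p)) * (tent 1 x - tent t x)) +
          eval x ((v - p) ^ 2) * (tent 1 x - tent t x)) := fun x => by
    simp only [map_pow, map_mul, map_sub]; ring
  have hnn : 0 ≤ ∫ x, eval x ((v - p) ^ 2) * (tent 1 x - tent t x) :=
    integral_nonneg fun x => mul_nonneg (by simpa using sq_nonneg _)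
      (sub_nonneg.mpr (max_le_max le_rfl (by linarith)))
  simp only [hexp]
  rw [integral_add (hI _) ?_, integral_add ((hI _).const_mul 2) (hI _), integral_const_mul, hcross]
  · linarith
  · exact ((hI _).const_mul 2).add (hI _)

lemma sq_eval_homogeneousComponent_mul_le {v : MvPolynomial (Fin n) ℝ} (hv : polyLap v = 0)
    (k : ℕ) {M δ : ℝ} (hM : ∀ x, normSq x ≤ 1 → |eval x v| ≤ M) (hδ : 0 < δ) (hδ' : δ < 1)
    {a : Fin n → ℝ} (ha : √(normSq a) + δ ≤ 1 - δ) :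
    eval a (homogeneousComponent k v) ^ 2 * (δ ^ n * ∫ x : Fin n → ℝ, tent 1 x) ≤
      M ^ 2 * ∫ x : Fin n → ℝ, tent 2 x := by
  set p := homogeneousComponent k v with hp
  set t := (1 - δ) ^ 2 with ht
  have ht1 : t < 1 := by nlinarith
  have hI (q : MvPolynomial (Fin n) ℝ) :
      Integrable fun x => eval x q * (tent 1 x - tent t x) := by
    simp only [mul_sub]
    exact (integrable_eval_mul_tent q 1).sub (integrable_eval_mul_tent q t)
  have hw0 (x : Fin n → ℝ) : 0 ≤ tent 1 x - tent t x :=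
    sub_nonneg.mpr (max_le_max le_rfl (by linarith))
  have hlocal : (1 - t) * ∫ x, eval (a + x) p ^ 2 * tent (δ ^ 2) x ≤
      δ ^ 2 * ∫ x, eval x (p ^ 2) * (tent 1 x - tent t x) := by
    rw [← integral_add_left_eq_self (fun x => eval x (p ^ 2) * (tent 1 x - tent t x)) a,
      ← integral_const_mul, ← integral_const_mul]
    have hL : Integrable fun x => eval (a + x) p ^ 2 * tent (δ ^ 2) x := by
      have h := integrable_eval_mul_tent (translate a p ^ 2) (δ ^ 2)
      simp only [map_pow (eval _), eval_translate] at h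
      exact h
    have hR : Integrable fun x => eval (a + x) (p ^ 2) * (tent 1 (a + x) - tent t (a + x)) :=
      (hI (p ^ 2)).comp_add_left a
    refine integral_mono (hL.const_mul _) (hR.const_mul _) fun x => ?_
    simp only [map_pow (eval _)]
    rcases le_total (δ ^ 2) (normSq x) with hx | hx
    · rw [tent_eq_zero hx, mul_zero, mul_zero]
      exact mul_nonneg (sq_nonneg _) (mul_nonneg (sq_nonneg _) (hw0 _))
    · have hax : normSq (a + x) ≤ t := by
        refine (Real.sqrt_le_left (by linarith)).mp ?_
        refine (sqrt_normSq_add_le a x).trans ?_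
        have := (Real.sqrt_le_left hδ.le).mpr hx
        linarith
      rw [tent_eq_sub (hax.trans ht1.le), tent_eq_sub hax, tent_eq_sub hx]
      have h1 : 0 ≤ (1 - t) * eval (a + x) p ^ 2 * normSq x :=
        mul_nonneg (mul_nonneg (by linarith) (sq_nonneg _)) (normSq_nonneg x)
      linarith
  have hglobal : ∫ x, eval x (v ^ 2) * (tent 1 x - tent t x) ≤
      (1 - t) * (M ^ 2 * ∫ x : Fin n → ℝ, tent 2 x) := by
    rw [← integral_const_mul, ← integral_const_mul]
    refine integral_mono (hI _) (((integrable_tent 2).const_mul _).const_mul _) fun x => ?_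
    simp only [map_pow]
    rcases le_total 1 (normSq x) with hx | hx
    · rw [tent_eq_zero hx, tent_eq_zero (ht1.le.trans hx), sub_zero, mul_zero]
      exact mul_nonneg (by linarith) (mul_nonneg (sq_nonneg _) (tent_nonneg _ _))
    · have h1 : eval x v ^ 2 ≤ M ^ 2 := sq_le_sq' (abs_le.mp (hM x hx)).1 (abs_le.mp (hM x hx)).2
      have h2 : tent 1 x - tent t x ≤ 1 - t := by
        rw [tent_eq_sub hx]
        linarith [le_max_right 0 (t - normSq x), show tent t x = max 0 (t - normSq x) from rfl]
      have h3 : 1 ≤ tent 2 x := by rw [tent_eq_sub (by linarith)]; linarith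
      calc eval x v ^ 2 * (tent 1 x - tent t x) ≤ M ^ 2 * (1 - t) :=
            mul_le_mul h1 h2 (hw0 x) (sq_nonneg _)
        _ = (1 - t) * (M ^ 2 * 1) := by ring
        _ ≤ (1 - t) * (M ^ 2 * tent 2 x) := by
            have : 0 ≤ 1 - t := by linarith
            gcongr
  have hmv := sq_eval_mul_integral_tent_le (polyLap_homogeneousComponent hv k) a (δ ^ 2)
  rw [integral_tent_sq hδ, ← hp] at hmv
  have hpars := integral_sq_homogeneousComponent_le hv k ht1.le
  have hpos : 0 < (1 - t) * δ ^ 2 := mul_pos (by linarith) (by positivity)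
  refine le_of_mul_le_mul_left ?_ hpos
  calc (1 - t) * δ ^ 2 * (eval a p ^ 2 * (δ ^ n * ∫ x : Fin n → ℝ, tent 1 x))
      = (1 - t) * (eval a p ^ 2 * (δ ^ 2 * δ ^ n * ∫ x : Fin n → ℝ, tent 1 x)) := by ring
    _ ≤ (1 - t) * ∫ x, eval (a + x) p ^ 2 * tent (δ ^ 2) x :=
        mul_le_mul_of_nonneg_left hmv (by linarith)
    _ ≤ δ ^ 2 * ∫ x, eval x (p ^ 2) * (tent 1 x - tent t x) := hlocal
    _ ≤ δ ^ 2 * ((1 - t) * (M ^ 2 * ∫ x : Fin n → ℝ, tent 2 x)) :=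
        mul_le_mul_of_nonneg_left (hpars.trans hglobal) (sq_nonneg _)
    _ = (1 - t) * δ ^ 2 * (M ^ 2 * ∫ x : Fin n → ℝ, tent 2 x) := by ring

/-! ### Maxima over the sphere -/

lemma mem_sphere_iff_normSq (θ : EuclideanSpace ℝ (Fin n)) :
    θ ∈ Metric.sphere (0 : EuclideanSpace ℝ (Fin n)) 1 ↔ normSq (θ : Fin n → ℝ) = 1 := by
  rw [mem_sphere_zero_iff_norm, normSq_eq_norm_sq, pow_eq_one_iff_of_nonneg (norm_nonneg θ) two_ne_zero]

lemma sphereMax_nonneg (p : MvPolynomial (Fin n) ℝ) : 0 ≤ sphereMax n p :=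
  Real.iSup_nonneg fun _ => Real.iSup_nonneg fun _ => abs_nonneg _

lemma sphereMax_le {p : MvPolynomial (Fin n) ℝ} {K : ℝ} (hK : 0 ≤ K)
    (h : ∀ x, normSq x = 1 → |eval x p| ≤ K) : sphereMax n p ≤ K :=
  Real.iSup_le (fun θ => Real.iSup_le (fun hθ => h _ ((mem_sphere_iff_normSq θ).mp hθ)) hK) hK

lemma abs_eval_le_sphereMax (p : MvPolynomial (Fin n) ℝ) {x : Fin n → ℝ} (hx : normSq x = 1) :
    |eval x p| ≤ sphereMax n p := by
  obtain ⟨K, hK⟩ := (isCompact_normSq_le (n := n) 1).exists_bound_of_continuousOn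
    (MvPolynomial.continuous_eval p).continuousOn
  have hK0 : 0 ≤ K := (norm_nonneg _).trans (hK x hx.le)
  have hmem := (mem_sphere_iff_normSq (WithLp.toLp 2 x)).mpr hx
  have hbdd : BddAbove (Set.range fun θ : EuclideanSpace ℝ (Fin n) =>
      ⨆ _ : θ ∈ Metric.sphere (0 : EuclideanSpace ℝ (Fin n)) 1, |eval (θ : Fin n → ℝ) p|) := by
    refine ⟨K, ?_⟩
    rintro _ ⟨θ, rfl⟩
    exact Real.iSup_le (fun hθ => hK _ ((mem_sphere_iff_normSq θ).mp hθ).le) hK0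
  refine le_trans ?_ (le_ciSup hbdd (WithLp.toLp 2 x))
  rw [ciSup_pos hmem]

end HarmonicPolynomial

open HarmonicPolynomial in
/-- There is a constant `C_n`, depending only on `n`, such that for every harmonic polynomial
`v = v_0 + ⋯ + v_m` with homogeneous components `v_k`, and `1 ≤ k ≤ m`:
`max_{S^{n-1}} |v_k| ≤ C_n k^{n/2} max_{S^{n-1}} |v|`. -/
theorem homogeneous_component_bound
    (n : ℕ) (hn : 1 ≤ n) :
    ∃ C : ℝ, 0 < C ∧ ∀ v : MvPolynomial (Fin n) ℝ, polyLap v = 0 →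
      ∀ k : ℕ, 1 ≤ k → k ≤ v.totalDegree →
        sphereMax n (homogeneousComponent k v) ≤
          C * (k : ℝ) ^ ((n : ℝ) / 2) * sphereMax n v := by
  set A := ∫ x : Fin n → ℝ, tent 1 x with hA
  set B := ∫ x : Fin n → ℝ, tent 2 x with hB
  have hA0 : 0 < A := integral_tent_one_pos
  have hAB : A ≤ B := MeasureTheory.integral_mono (integrable_tent 1) (integrable_tent 2)
    fun x => max_le_max le_rfl (by linarith)
  have hB0 : 0 < B := hA0.trans_le hAB
  refine ⟨√(4 * 4 ^ n * B / A), by positivity, fun v hv k hk _ => ?_⟩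
  have hk0 : (0 : ℝ) < k := by exact_mod_cast hk
  have hk1 : (1 : ℝ) ≤ k := by exact_mod_cast hk
  set M := sphereMax n v with hMdef
  have hM0 : 0 ≤ M := sphereMax_nonneg v
  refine sphereMax_le (by positivity) fun x hx => ?_
  set δ : ℝ := 1 / (4 * k) with hδ
  have hδ0 : 0 < δ := by positivity
  have hδk : δ * k = 1 / 4 := by rw [hδ]; field_simp
  have hδ4 : δ ≤ 1 / 4 := by nlinarith
  have hpow : (1 : ℝ) / 2 ≤ (1 - 2 * δ) ^ k := by
    have := one_add_mul_le_pow (a := -(2 * δ)) (by linarith) k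
    rw [← sub_eq_add_neg] at this
    nlinarith
  have hmain := sq_eval_homogeneousComponent_mul_le hv k (M := M) (δ := δ) (a := (1 - 2 * δ) • x)
    (fun y hy => abs_eval_le_of_forall_sphere hn hv (fun z hz => abs_eval_le_sphereMax v hz) hy)
    hδ0 (by linarith) (by
      rw [normSq_smul, hx, mul_one, Real.sqrt_sq (by linarith)]; linarith)
  rw [eval_smul_of_isHomogeneous (homogeneousComponent_isHomogeneous k v), ← hA, ← hB] at hmain
  set y := eval x (homogeneousComponent k v)
  have hy : y ^ 2 ≤ 4 * ((1 - 2 * δ) ^ k * y) ^ 2 := by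
    have : (1 : ℝ) / 4 ≤ ((1 - 2 * δ) ^ k) ^ 2 := by nlinarith
    nlinarith [sq_nonneg y]
  have hδn : δ ^ n * (4 ^ n * (k : ℝ) ^ n) = 1 := by
    rw [← mul_pow, ← mul_pow, hδ, one_div, inv_mul_cancel₀ (by positivity), one_pow]
  refine abs_le_of_sq_le_sq ?_ (by positivity)
  have hkn : ((k : ℝ) ^ ((n : ℝ) / 2)) ^ 2 = (k : ℝ) ^ n := by
    rw [← Real.rpow_natCast, ← Real.rpow_mul hk0.le, ← Real.rpow_natCast]
    congr 1; push_cast; ring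
  rw [mul_pow, mul_pow, Real.sq_sqrt (by positivity), hkn]
  calc y ^ 2 ≤ 4 * ((1 - 2 * δ) ^ k * y) ^ 2 := hy
    _ = 4 * (4 ^ n * (k : ℝ) ^ n) / A * (((1 - 2 * δ) ^ k * y) ^ 2 * (δ ^ n * A)) := by
        rw [← mul_one (4 * _), ← hδn]
        field_simp
    _ ≤ 4 * (4 ^ n * (k : ℝ) ^ n) / A * (M ^ 2 * B) := by gcongr
    _ = 4 * 4 ^ n * B / A * (k : ℝ) ^ n * M ^ 2 := by ring
end

section
/- Let Ω = { x ∈ ℝ^n : Σ_{j=1}^{n-1} x_j²/a_j² < 1 } be an ellipsoidal cylinder with a_1, …, a_{n-1} > 0 and boundary Γ = ∂Ω. For each polynomial f on ℝ^n of degree at most m, there exists a unique polynomial u of degree at most m such that Δu = 0 on ℝ^n and u(x) = f(x) for all x ∈ Γ. -/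
open MvPolynomial Filter

namespace MvPolynomial

theorem totalDegree_pderiv_le {σ R : Type*} [CommSemiring R] (i : σ) (p : MvPolynomial σ R) :
    (pderiv i p).totalDegree ≤ p.totalDegree - 1 := by
  classical
  refine Finset.sup_le fun s hs ↦ ?_
  rw [mem_support_iff, coeff_pderiv] at hs
  have hmem : s + Finsupp.single i 1 ∈ p.support :=
    mem_support_iff.2 (left_ne_zero_of_mul hs)
  have h := le_totalDegree hmem
  rw [Finsupp.sum_add_index' (fun _ ↦ rfl) (fun _ _ _ ↦ rfl),
    Finsupp.sum_single_index rfl] at h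
  omega

theorem pderiv_comm {σ R : Type*} [CommRing R] (i j : σ) (p : MvPolynomial σ R) :
    pderiv i (pderiv j p) = pderiv j (pderiv i p) := by
  classical
  have h : ⁅(pderiv i : Derivation R (MvPolynomial σ R) (MvPolynomial σ R)),
      (pderiv j : Derivation R (MvPolynomial σ R) (MvPolynomial σ R))⁆ = 0 := by
    refine derivation_ext fun k ↦ ?_
    rw [Derivation.commutator_apply, pderiv_X, pderiv_X]
    simp [Pi.single_apply, apply_ite]
  have := congrArg (fun D : Derivation R (MvPolynomial σ R) (MvPolynomial σ R) ↦ D p) h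
  simpa [Derivation.commutator_apply, sub_eq_zero] using this

theorem hasDerivAt_eval_update {σ : Type*} [DecidableEq σ] (x : σ → ℝ) (i : σ)
    (p : MvPolynomial σ ℝ) (t : ℝ) :
    HasDerivAt (fun s ↦ eval (Function.update x i s) p)
      (eval (Function.update x i t) (pderiv i p)) t := by
  induction p using MvPolynomial.induction_on with
  | C a => simpa using hasDerivAt_const t a
  | add p q hp hq =>
    simp only [map_add]
    exact hp.add hq
  | mul_X p j hp =>
    have hX : HasDerivAt (fun s ↦ Function.update x i s j)
        (eval (Function.update x i t) (pderiv i (X j))) t := by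
      rcases eq_or_ne j i with rfl | hj
      · simpa using hasDerivAt_id' t
      · simpa [hj, pderiv_X_of_ne hj] using hasDerivAt_const t (x j)
    have h := hp.mul hX
    simp only [map_mul, eval_X]
    refine h.congr_deriv ?_
    rw [pderiv_mul]
    simp

theorem eval_pderiv_pderiv_nonpos_of_isLocalMax {σ : Type*} [DecidableEq σ] {x : σ → ℝ} {i : σ}
    {p : MvPolynomial σ ℝ} (h : IsLocalMax (fun s ↦ eval (Function.update x i s) p) (x i)) :
    eval x (pderiv i (pderiv i p)) ≤ 0 := by
  by_contra! hpos
  have hd : deriv (fun s ↦ eval (Function.update x i s) p) =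
      fun s ↦ eval (Function.update x i s) (pderiv i p) :=
    _root_.funext fun s ↦ (hasDerivAt_eval_update x i p s).deriv
  have hdd : deriv (deriv fun s ↦ eval (Function.update x i s) p) =
      fun s ↦ eval (Function.update x i s) (pderiv i (pderiv i p)) := by
    rw [hd]
    exact _root_.funext fun s ↦ (hasDerivAt_eval_update x i _ s).deriv
  have hmin : IsLocalMin (fun s ↦ eval (Function.update x i s) p) (x i) :=
    isLocalMin_of_deriv_deriv_pos (by simpa [hdd] using hpos) h.deriv_eq_zero
      (hasDerivAt_eval_update x i p _).continuousAt
  have hconst : (fun s ↦ eval (Function.update x i s) p) =ᶠ[nhds (x i)]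
      fun _ ↦ eval (Function.update x i (x i)) p := by
    filter_upwards [h, hmin] with s h₁ h₂ using le_antisymm h₁ h₂
  have h0 := hconst.deriv.deriv_eq
  simp [hdd] at h0
  exact hpos.ne' h0

theorem eval_update_of_pderiv_eq_zero {σ : Type*} [DecidableEq σ] {i : σ}
    {p : MvPolynomial σ ℝ} (h : pderiv i p = 0) (x : σ → ℝ) (t : ℝ) :
    eval (Function.update x i t) p = eval x p := by
  have hd (s : ℝ) := hasDerivAt_eval_update x i p s
  simp only [h, map_zero] at hd
  have := is_const_of_deriv_eq_zero (fun s ↦ (hd s).differentiableAt) (fun s ↦ (hd s).deriv)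
    t (x i)
  simpa using this

end MvPolynomial

/-- The Laplacian as a linear map. -/
noncomputable def polyLapLinear (n : ℕ) : MvPolynomial (Fin n) ℝ →ₗ[ℝ] MvPolynomial (Fin n) ℝ :=
  ∑ i, (pderiv i).toLinearMap ∘ₗ (pderiv i).toLinearMap

theorem polyLap_eq_polyLapLinear {n : ℕ} (p : MvPolynomial (Fin n) ℝ) :
    polyLap p = polyLapLinear n p := by
  simp [polyLap, polyLapLinear]

theorem totalDegree_polyLap_le {n : ℕ} (p : MvPolynomial (Fin n) ℝ) :
    (polyLap p).totalDegree ≤ p.totalDegree - 2 := by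
  refine totalDegree_finsetSum_le fun i _ ↦ ?_
  have h₁ := totalDegree_pderiv_le i (pderiv i p)
  have h₂ := totalDegree_pderiv_le i p
  omega

theorem polyLap_pderiv {n : ℕ} (l : Fin n) (p : MvPolynomial (Fin n) ℝ) :
    polyLap (pderiv l p) = pderiv l (polyLap p) := by
  simp only [polyLap, map_sum]
  refine Finset.sum_congr rfl fun i _ ↦ ?_
  rw [pderiv_comm i l, pderiv_comm i l]

/-- The quadratic polynomial `∑ b_i x_i² - 1`. -/
noncomputable def diagQuadric {n : ℕ} (b : Fin n → ℝ) : MvPolynomial (Fin n) ℝ :=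
  ∑ i, C (b i) * X i ^ 2 - 1

theorem eval_diagQuadric {n : ℕ} (b x : Fin n → ℝ) :
    eval x (diagQuadric b) = ∑ i, b i * x i ^ 2 - 1 := by
  simp [diagQuadric]

theorem totalDegree_diagQuadric_le {n : ℕ} (b : Fin n → ℝ) :
    (diagQuadric b).totalDegree ≤ 2 := by
  refine (totalDegree_sub _ _).trans (max_le (totalDegree_finsetSum_le fun i _ ↦ ?_) (by simp))
  refine (totalDegree_mul _ _).trans ?_
  simp

theorem pderiv_diagQuadric {n : ℕ} (b : Fin n → ℝ) (i : Fin n) :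
    pderiv i (diagQuadric b) = C (2 * b i) * X i := by
  simp only [diagQuadric, map_sub, map_sum, pderiv_C_mul, pderiv_pow, pderiv_X, pderiv_one,
    Pi.single_apply]
  simp [map_ofNat]
  ring

theorem polyLap_diagQuadric {n : ℕ} (b : Fin n → ℝ) :
    polyLap (diagQuadric b) = C (∑ i, 2 * b i) := by
  simp only [polyLap, pderiv_diagQuadric, pderiv_C_mul, pderiv_X_self, mul_one, map_sum]

section Cylinder

variable {n : ℕ} {l : Fin n} {b : Fin n → ℝ}

theorem isCompact_cylinder_slice (hbl : b l = 0) (hb : ∀ i ≠ l, 0 < b i) :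
    IsCompact {x : Fin n → ℝ | x l = 0 ∧ eval x (diagQuadric b) ≤ 0} := by
  refine (isCompact_Icc (a := fun i ↦ -(1 / b i + 1)) (b := fun i ↦ 1 / b i + 1)).of_isClosed_subset
    ((isClosed_eq (continuous_apply l) continuous_const).inter
      (isClosed_le (continuous_eval _) continuous_const)) ?_
  rintro x ⟨hxl, hx⟩
  rw [eval_diagQuadric] at hx
  have hb0 (i : Fin n) : 0 ≤ b i := by
    rcases eq_or_ne i l with rfl | h
    · exact hbl.ge
    · exact (hb i h).le
  have key (i : Fin n) : |x i| ≤ 1 / b i + 1 := by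
    rcases eq_or_ne i l with rfl | h
    · simp [hxl, hbl]
    have h₁ : b i * x i ^ 2 ≤ ∑ j, b j * x j ^ 2 :=
      Finset.single_le_sum (f := fun j ↦ b j * x j ^ 2)
        (fun j _ ↦ mul_nonneg (hb0 j) (sq_nonneg _)) (Finset.mem_univ i)
    have h₂ : x i ^ 2 ≤ 1 / b i := by
      rw [le_div_iff₀ (hb i h)]
      linarith
    nlinarith [sq_abs (x i), sq_nonneg (|x i| - 1)]
  exact ⟨fun i ↦ (abs_le.1 (key i)).1, fun i ↦ (abs_le.1 (key i)).2⟩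

theorem eval_nonpos_on_slice (hbl : b l = 0) (hb : ∀ i ≠ l, 0 < b i) (hne : ∃ i, i ≠ l)
    {u : MvPolynomial (Fin n) ℝ} (hu : polyLap u = 0) (hul : pderiv l u = 0)
    (hΓ : ∀ x, eval x (diagQuadric b) = 0 → eval x u = 0)
    {x : Fin n → ℝ} (hxl : x l = 0) (hx : eval x (diagQuadric b) ≤ 0) :
    eval x u ≤ 0 := by
  have hε : ∀ ε > 0, eval x u + ε * eval x (diagQuadric b) ≤ 0 := by
    intro ε hε
    set g := u + C ε * diagQuadric b with hg
    have hgx (y : Fin n → ℝ) : eval y g = eval y u + ε * eval y (diagQuadric b) := by simp [hg]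
    obtain ⟨z, ⟨hzl, hz⟩, hmax⟩ := (isCompact_cylinder_slice hbl hb).exists_isMaxOn
      ⟨x, hxl, hx⟩ (f := fun y ↦ eval y g) (continuous_eval g).continuousOn
    have hxz : eval x g ≤ eval z g := hmax ⟨hxl, hx⟩
    rcases hz.lt_or_eq with hlt | heq
    · exfalso
      have hlap : polyLap g = C (ε * ∑ i, 2 * b i) := by
        have : polyLap g = polyLap u + ε • polyLap (diagQuadric b) := by
          simp only [polyLap_eq_polyLapLinear, hg, ← smul_eq_C_mul, map_add, map_smul]
        rw [this, hu, polyLap_diagQuadric, smul_eq_C_mul, zero_add, map_mul]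
      have hle : eval z (polyLap g) ≤ 0 := by
        rw [polyLap, map_sum]
        refine Finset.sum_nonpos fun i _ ↦ ?_
        rcases eq_or_ne i l with rfl | hi
        · simp [hg, hul, pderiv_diagQuadric, hbl]
        · refine eval_pderiv_pderiv_nonpos_of_isLocalMax ?_
          have hcont : Continuous fun s ↦ eval (Function.update z i s) (diagQuadric b) :=
            continuous_iff_continuousAt.2 fun s ↦ (hasDerivAt_eval_update z i _ s).continuousAt
          have hev : ∀ᶠ s in nhds (z i), eval (Function.update z i s) (diagQuadric b) < 0 :=
            hcont.continuousAt.eventually_lt continuousAt_const (by simpa using hlt)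
          filter_upwards [hev] with s hs
          have : Function.update z i s l = 0 := by rw [Function.update_of_ne hi.symm, hzl]
          simpa using hmax ⟨this, hs.le⟩
      rw [hlap, eval_C] at hle
      obtain ⟨j, hj⟩ := hne
      have hsum : 0 < ∑ i, 2 * b i := by
        refine Finset.sum_pos' (fun i _ ↦ ?_) ⟨j, Finset.mem_univ j, by linarith [hb j hj]⟩
        rcases eq_or_ne i l with rfl | hi
        · simp [hbl]
        · linarith [hb i hi]
      exact hle.not_gt (mul_pos hε hsum)
    · rw [hgx, hgx, heq, hΓ z heq] at hxz
      simpa using hxz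
  have hlim : Tendsto (fun ε : ℝ ↦ eval x u + ε * eval x (diagQuadric b))
      (nhdsWithin 0 (Set.Ioi 0)) (nhds (eval x u)) := by
    refine tendsto_nhdsWithin_of_tendsto_nhds (Continuous.tendsto' ?_ _ _ (by simp))
    fun_prop
  exact le_of_tendsto hlim (eventually_nhdsWithin_of_forall hε)

theorem eq_zero_of_pderiv_eq_zero (hbl : b l = 0) (hb : ∀ i ≠ l, 0 < b i) (hne : ∃ i, i ≠ l)
    {u : MvPolynomial (Fin n) ℝ} (hu : polyLap u = 0) (hul : pderiv l u = 0)
    (hΓ : ∀ x, eval x (diagQuadric b) = 0 → eval x u = 0) : u = 0 := by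
  have hneg : polyLap (-u) = 0 := by
    rw [polyLap_eq_polyLapLinear] at hu ⊢
    rw [map_neg, hu, neg_zero]
  have hzero (x : Fin n → ℝ) (hx : eval x (diagQuadric b) < 0) : eval x u = 0 := by
    set y := Function.update x l 0
    have hyl : y l = 0 := by simp [y]
    have hy : eval y (diagQuadric b) ≤ 0 := by
      rw [eval_update_of_pderiv_eq_zero (by simp [pderiv_diagQuadric, hbl])]
      exact hx.le
    have h₁ := eval_nonpos_on_slice hbl hb hne hu hul hΓ hyl hy
    have h₂ := eval_nonpos_on_slice hbl hb hne hneg (by simp [hul])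
      (fun z hz ↦ by simp [hΓ z hz]) hyl hy
    rw [← eval_update_of_pderiv_eq_zero hul x 0]
    rw [map_neg] at h₂
    change eval y u = 0
    linarith
  have hopen : IsOpen {x : Fin n → ℝ | eval x (diagQuadric b) < 0} :=
    isOpen_lt (continuous_eval _) continuous_const
  obtain ⟨δ, hδ, hball⟩ := Metric.isOpen_iff.1 hopen 0 (by simp [eval_diagQuadric])
  refine funext_set (fun i ↦ Metric.ball ((0 : Fin n → ℝ) i) δ) (fun i ↦ ?_) fun x hx ↦ ?_
  · rw [Real.ball_eq_Ioo]
    exact Set.Ioo_infinite (by linarith)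
  · rw [ball_pi _ hδ] at hball
    rw [hzero x (hball hx), map_zero]

theorem eq_zero_of_polyLap_eq_zero (hbl : b l = 0) (hb : ∀ i ≠ l, 0 < b i) (hne : ∃ i, i ≠ l)
    {u : MvPolynomial (Fin n) ℝ} (hu : polyLap u = 0)
    (hΓ : ∀ x, eval x (diagQuadric b) = 0 → eval x u = 0) : u = 0 := by
  induction hd : u.totalDegree using Nat.strong_induction_on generalizing u with
  | _ d ih =>
    refine eq_zero_of_pderiv_eq_zero hbl hb hne hu ?_ hΓ
    rcases Nat.eq_zero_or_pos d with rfl | hpos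
    · rw [totalDegree_eq_zero_iff_eq_C.1 hd, pderiv_C]
    have hdeg := totalDegree_pderiv_le l u
    refine ih _ (by omega) (by rw [polyLap_pderiv, hu, map_zero]) (fun x hx ↦ ?_) rfl
    have hline : (fun s ↦ eval (Function.update x l s) u) = fun _ ↦ 0 := by
      funext s
      refine hΓ _ ?_
      rw [eval_update_of_pderiv_eq_zero (by simp [pderiv_diagQuadric, hbl]), hx]
    have h := hasDerivAt_eval_update x l u (x l)
    rw [hline] at h
    simpa using h.unique (hasDerivAt_const _ _)

theorem exists_polyLap_diagQuadric_mul (hbl : b l = 0) (hb : ∀ i ≠ l, 0 < b i)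
    (hne : ∃ i, i ≠ l) {k : ℕ} {h : MvPolynomial (Fin n) ℝ} (hh : h.totalDegree ≤ k) :
    ∃ v : MvPolynomial (Fin n) ℝ, v.totalDegree ≤ k ∧ polyLap (diagQuadric b * v) = h := by
  let T := polyLapLinear n ∘ₗ LinearMap.mulLeft ℝ (diagQuadric b)
  have hTv (v : MvPolynomial (Fin n) ℝ) : T v = polyLap (diagQuadric b * v) := by
    simp [T, polyLap_eq_polyLapLinear]
  have hT : ∀ v ∈ restrictTotalDegree (Fin n) ℝ k, T v ∈ restrictTotalDegree (Fin n) ℝ k := by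
    intro v hv
    rw [mem_restrictTotalDegree] at hv ⊢
    rw [hTv]
    have h₁ := totalDegree_polyLap_le (diagQuadric b * v)
    have h₂ := totalDegree_mul (diagQuadric b) v
    have h₃ := totalDegree_diagQuadric_le b
    omega
  have hQ : diagQuadric b ≠ 0 := fun h0 ↦ by
    have := eval_diagQuadric b 0
    simp [h0] at this
  have hinj : Function.Injective (T.restrict hT) := by
    rw [← LinearMap.ker_eq_bot, LinearMap.ker_eq_bot']
    rintro ⟨v, hv⟩ h0
    have h0' : polyLap (diagQuadric b * v) = 0 := by
      rw [← hTv]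
      exact congrArg Subtype.val h0
    have := eq_zero_of_polyLap_eq_zero hbl hb hne h0' (fun x hx ↦ by simp [hx])
    exact Subtype.ext ((mul_eq_zero.1 this).resolve_left hQ)
  obtain ⟨⟨v, hv⟩, hvh⟩ := LinearMap.injective_iff_surjective.1 hinj
    ⟨h, (mem_restrictTotalDegree _ _ _).2 hh⟩
  refine ⟨v, (mem_restrictTotalDegree _ _ _).1 hv, ?_⟩
  rw [← hTv]
  exact congrArg Subtype.val hvh

theorem existsUnique_harmonic_of_diagQuadric (hbl : b l = 0) (hb : ∀ i ≠ l, 0 < b i)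
    (hne : ∃ i, i ≠ l) {m : ℕ} {f : MvPolynomial (Fin n) ℝ} (hf : f.totalDegree ≤ m) :
    ∃! u : MvPolynomial (Fin n) ℝ, u.totalDegree ≤ m ∧ polyLap u = 0 ∧
      ∀ x : Fin n → ℝ, eval x (diagQuadric b) = 0 → eval x u = eval x f := by
  have hsub (p q : MvPolynomial (Fin n) ℝ) : polyLap (p - q) = polyLap p - polyLap q := by
    simp only [polyLap_eq_polyLapLinear, map_sub]
  refine existsUnique_of_exists_of_unique ?_ ?_
  · rcases lt_or_ge m 2 with hm | hm
    · refine ⟨f, hf, ?_, fun _ _ ↦ rfl⟩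
      refine Finset.sum_eq_zero fun i _ ↦ ?_
      have hdeg := totalDegree_pderiv_le i f
      rw [totalDegree_eq_zero_iff_eq_C.1 (by omega : (pderiv i f).totalDegree = 0), pderiv_C]
    · have hdeg := totalDegree_polyLap_le f
      obtain ⟨v, hv, hvf⟩ := exists_polyLap_diagQuadric_mul hbl hb hne
        (by omega : (polyLap f).totalDegree ≤ m - 2)
      refine ⟨f - diagQuadric b * v, ?_, by rw [hsub, hvf, sub_self], fun x hx ↦ by simp [hx]⟩
      have h₂ := totalDegree_mul (diagQuadric b) v
      have h₃ := totalDegree_diagQuadric_le b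
      exact (totalDegree_sub _ _).trans (max_le hf (by omega))
  · rintro u w ⟨-, hu, huf⟩ ⟨-, hw, hwf⟩
    refine sub_eq_zero.1 (eq_zero_of_polyLap_eq_zero hbl hb hne ?_ fun x hx ↦ ?_)
    · rw [hsub, hu, hw, sub_self]
    · rw [map_sub, huf x hx, hwf x hx, sub_self]

end Cylinder

/-- On the ellipsoidal cylinder `Ω = {∑_{j<n-1} x_j²/a_j² < 1} ⊆ ℝⁿ`, every polynomial
Dirichlet data of degree at most `m` admits a unique harmonic polynomial solution of
degree at most `m` (matching the data on the boundary `Γ = {∑ x_j²/a_j² = 1}`). -/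
theorem polynomial_dirichlet_cylinder
    (n : ℕ) (hn : 2 ≤ n) (a : Fin (n - 1) → ℝ) (ha : ∀ j, 0 < a j) (m : ℕ)
    (f : MvPolynomial (Fin n) ℝ) (hf : f.totalDegree ≤ m) :
    ∃! u : MvPolynomial (Fin n) ℝ, u.totalDegree ≤ m ∧ polyLap u = 0 ∧
      ∀ x : Fin n → ℝ,
        (∑ j : Fin (n - 1), (x (Fin.castLE (Nat.sub_le n 1) j)) ^ 2 / (a j) ^ 2) = 1 →
        eval x u = eval x f := by
  obtain ⟨k, rfl⟩ : ∃ k, n = k + 1 := ⟨n - 1, by omega⟩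
  let a' : Fin k → ℝ := a
  let b : Fin (k + 1) → ℝ := Fin.snoc (fun j : Fin k ↦ (a' j ^ 2)⁻¹) 0
  have hb : ∀ i ≠ Fin.last k, 0 < b i := by
    intro i
    refine Fin.lastCases (fun h ↦ absurd rfl h) (fun j _ ↦ ?_) i
    have : 0 < a' j := ha j
    simp only [b, Fin.snoc_castSucc]
    positivity
  have hne : ∃ i, i ≠ Fin.last k := ⟨0, fun h ↦ by simp [Fin.ext_iff] at h; omega⟩
  have hΓ (x : Fin (k + 1) → ℝ) :
      (∑ j : Fin (k + 1 - 1), (x (Fin.castLE (Nat.sub_le (k + 1) 1) j)) ^ 2 / (a j) ^ 2) = 1 ↔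
        eval x (diagQuadric b) = 0 := by
    rw [eval_diagQuadric, sub_eq_zero, Fin.sum_univ_castSucc]
    simp only [b, Fin.snoc_castSucc, Fin.snoc_last, zero_mul, add_zero, inv_mul_eq_div]
    rfl
  simp only [hΓ]
  exact existsUnique_harmonic_of_diagQuadric (l := Fin.last k) (by simp [b]) hb hne hf
end

section
/- Let p(x) = Σ_{j=1}^{n-1} x_j²/a_j² − 1 with a_1, …, a_{n-1} > 0. If q is a polynomial in n variables such that Δ(p·q) = 0 identically on ℝ^n, then q = 0. -/
open MvPolynomial Filter

open MeasureTheory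

theorem integrable_pow_mul_exp_neg_half_sq (k : ℕ) :
    Integrable fun x : ℝ => x ^ k * Real.exp (-(1 / 2) * x ^ 2) := by
  simpa using integrable_rpow_mul_exp_neg_mul_sq (b := 1 / 2) (by norm_num) (s := k)
    (by have : (0 : ℝ) ≤ k := k.cast_nonneg
        linarith)

theorem integral_pow_succ_mul_exp_neg_half_sq (k : ℕ) :
    ∫ x : ℝ, x ^ (k + 1) * Real.exp (-(1 / 2) * x ^ 2) =
      k * ∫ x : ℝ, x ^ (k - 1) * Real.exp (-(1 / 2) * x ^ 2) := by
  have hd : ∀ x : ℝ, HasDerivAt (fun x : ℝ => x ^ k * Real.exp (-(1 / 2) * x ^ 2))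
      (k * (x ^ (k - 1) * Real.exp (-(1 / 2) * x ^ 2)) -
        x ^ (k + 1) * Real.exp (-(1 / 2) * x ^ 2)) x := by
    intro x
    convert! (hasDerivAt_pow k x).mul (((hasDerivAt_pow 2 x).const_mul (-(1 / 2))).exp) using 1
    push_cast
    ring
  have h1 := (integrable_pow_mul_exp_neg_half_sq (k - 1)).const_mul (k : ℝ)
  have h2 := integrable_pow_mul_exp_neg_half_sq (k + 1)
  have h := integral_eq_zero_of_hasDerivAt_of_integrable hd (h1.sub h2)
    (integrable_pow_mul_exp_neg_half_sq k)
  rw [integral_sub h1 h2, integral_const_mul] at h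
  linarith

namespace MvPolynomial

variable {n : ℕ}

/-- A polynomial times the Gaussian weight `exp (-|x|² / 2)`. -/
noncomputable def mulGaussian (p : MvPolynomial (Fin n) ℝ) (x : Fin n → ℝ) : ℝ :=
  eval x p * ∏ i, Real.exp (-(1 / 2) * x i ^ 2)

theorem mulGaussian_monomial (α : Fin n →₀ ℕ) (c : ℝ) :
    mulGaussian (monomial α c) =
      fun x => c * ∏ i, (x i ^ α i * Real.exp (-(1 / 2) * x i ^ 2)) := by
  ext x
  rw [mulGaussian, eval_monomial, Finsupp.prod_fintype _ _ (by simp), Finset.prod_mul_distrib,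
    mul_assoc]

theorem mulGaussian_add (p q : MvPolynomial (Fin n) ℝ) :
    mulGaussian (p + q) = fun x => mulGaussian p x + mulGaussian q x := by
  ext x
  simp only [mulGaussian, map_add, add_mul]

theorem integrable_mulGaussian (p : MvPolynomial (Fin n) ℝ) : Integrable (mulGaussian p) := by
  induction p using MvPolynomial.induction_on' with
  | monomial α c =>
    rw [mulGaussian_monomial]
    exact (Integrable.fintype_prod (f := fun i (t : ℝ) => t ^ α i * Real.exp (-(1 / 2) * t ^ 2))
      fun i => integrable_pow_mul_exp_neg_half_sq (α i)).const_mul c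
  | add p q hp hq =>
    rw [mulGaussian_add]
    exact hp.add hq

/-- Integration of polynomials against `exp (-|x|² / 2)`. -/
noncomputable def gaussianIntegral : MvPolynomial (Fin n) ℝ →ₗ[ℝ] ℝ where
  toFun p := ∫ x, mulGaussian p x
  map_add' p q := by
    rw [mulGaussian_add, integral_add (integrable_mulGaussian p) (integrable_mulGaussian q)]
  map_smul' c p := by
    rw [RingHom.id_apply, smul_eq_mul, ← integral_const_mul]
    simp only [mulGaussian, smul_eval, mul_assoc]

theorem gaussianIntegral_apply (p : MvPolynomial (Fin n) ℝ) :
    gaussianIntegral p = ∫ x, mulGaussian p x := rfl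

theorem gaussianIntegral_monomial (α : Fin n →₀ ℕ) (c : ℝ) :
    gaussianIntegral (monomial α c) =
      c * ∏ i, ∫ t : ℝ, t ^ α i * Real.exp (-(1 / 2) * t ^ 2) := by
  rw [gaussianIntegral_apply, mulGaussian_monomial, integral_const_mul,
    integral_fintype_prod_volume_eq_prod
      fun i (t : ℝ) => t ^ α i * Real.exp (-(1 / 2) * t ^ 2)]

theorem gaussianIntegral_X_mul (i : Fin n) (p : MvPolynomial (Fin n) ℝ) :
    gaussianIntegral (X i * p) = gaussianIntegral (pderiv i p) := by
  induction p using MvPolynomial.induction_on' with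
  | monomial α c =>
    rw [X, monomial_mul, pderiv_monomial, gaussianIntegral_monomial, gaussianIntegral_monomial,
      ← Finset.mul_prod_erase _ _ (Finset.mem_univ i),
      ← Finset.mul_prod_erase _ _ (Finset.mem_univ i)]
    have hL : ∀ j ∈ Finset.univ.erase i, (Finsupp.single i 1 + α : Fin n →₀ ℕ) j = α j := by
      intro j hj
      simp [(Finset.ne_of_mem_erase hj).symm]
    have hR : ∀ j ∈ Finset.univ.erase i, (α - Finsupp.single i 1 : Fin n →₀ ℕ) j = α j := by
      intro j hj
      simp [(Finset.ne_of_mem_erase hj).symm]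
    rw [Finset.prod_congr rfl fun j hj => by rw [hL j hj],
      Finset.prod_congr (s₁ := Finset.univ.erase i)
        (f := fun j => ∫ t : ℝ, t ^ (α - Finsupp.single i 1 : Fin n →₀ ℕ) j *
          Real.exp (-(1 / 2) * t ^ 2)) rfl fun j hj => by rw [hR j hj]]
    simp only [Finsupp.add_apply, Finsupp.tsub_apply, Finsupp.single_eq_same, one_mul]
    rw [add_comm 1, integral_pow_succ_mul_exp_neg_half_sq]
    ring
  | add p q hp hq => rw [mul_add, map_add, map_add, map_add, hp, hq]

theorem gaussianIntegral_sq_nonneg (p : MvPolynomial (Fin n) ℝ) :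
    0 ≤ gaussianIntegral (p ^ 2) :=
  integral_nonneg fun x => mul_nonneg (by rw [map_pow]; positivity) (by positivity)

theorem eq_zero_of_gaussianIntegral_sq_eq_zero {p : MvPolynomial (Fin n) ℝ}
    (h : gaussianIntegral (p ^ 2) = 0) : p = 0 := by
  have hnn : 0 ≤ mulGaussian (p ^ 2) := fun x =>
    mul_nonneg (by rw [map_pow]; positivity) (by positivity)
  have hc : Continuous (mulGaussian (p ^ 2)) := by
    unfold mulGaussian
    have := continuous_eval (p ^ 2)
    fun_prop
  have h0 := (integral_eq_zero_iff_of_nonneg hnn (integrable_mulGaussian _)).1 h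
  have h1 : mulGaussian (p ^ 2) = 0 := hc.ae_eq_iff_eq volume continuous_zero |>.1 h0
  refine MvPolynomial.funext fun x => ?_
  have hx := congrFun h1 x
  rw [Pi.zero_apply, mulGaussian, map_pow] at hx
  rw [map_zero]
  exact pow_eq_zero_iff two_ne_zero |>.1 <| (mul_eq_zero.1 hx).resolve_right (by positivity)

theorem homogeneousComponent_pderiv (d : ℕ) (i : Fin n) (p : MvPolynomial (Fin n) ℝ) :
    homogeneousComponent d (pderiv i p) = pderiv i (homogeneousComponent (d + 1) p) := by
  ext m
  simp [coeff_homogeneousComponent, coeff_pderiv, map_add]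

theorem homogeneousComponent_polyLap (d : ℕ) (p : MvPolynomial (Fin n) ℝ) :
    homogeneousComponent d (polyLap p) = polyLap (homogeneousComponent (d + 2) p) := by
  simp only [polyLap, map_sum, homogeneousComponent_pderiv]

theorem IsHomogeneous.homogeneousComponent_mul {m : ℕ} {p : MvPolynomial (Fin n) ℝ}
    (hp : p.IsHomogeneous m) (d : ℕ) (q : MvPolynomial (Fin n) ℝ) :
    homogeneousComponent (d + m) (p * q) = p * homogeneousComponent d q := by
  induction q using MvPolynomial.induction_on' with
  | monomial α c =>
    have hα : (monomial α c).IsHomogeneous α.degree := isHomogeneous_monomial c rfl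
    rw [homogeneousComponent_of_mem (hp.mul hα), homogeneousComponent_of_mem hα]
    simp [add_comm d m]
  | add q r hq hr => rw [mul_add, map_add, map_add, mul_add, hq, hr]

theorem polyLap_pderiv (i : Fin n) (p : MvPolynomial (Fin n) ℝ) :
    polyLap (pderiv i p) = pderiv i (polyLap p) := by
  have hcomm : ∀ (j : Fin n) (q : MvPolynomial (Fin n) ℝ),
      pderiv j (pderiv i q) = pderiv i (pderiv j q) := by
    intro j q
    ext m
    simp only [coeff_pderiv, Finsupp.add_apply, Nat.cast_add, add_right_comm m]
    rcases eq_or_ne i j with rfl | hij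
    · rfl
    · simp [hij, hij.symm]
      ring
  simp only [polyLap, map_sum, hcomm]

/-- A homogeneous harmonic polynomial is Gaussian-orthogonal to homogeneous polynomials of lower
degree. -/
theorem gaussianIntegral_mul_eq_zero_of_polyLap_eq_zero {m : ℕ} :
    ∀ {k : ℕ} {f g : MvPolynomial (Fin n) ℝ}, f.IsHomogeneous m → polyLap f = 0 →
      g.IsHomogeneous k → k < m → gaussianIntegral (f * g) = 0 := by
  induction m with
  | zero => exact fun _ _ _ hk => absurd hk (Nat.not_lt_zero _)
  | succ m ih =>
    intro k f g hf hlap hg hk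
    have hterm : ∀ i, gaussianIntegral (pderiv i f * pderiv i g) = 0 := by
      intro i
      rcases k with _ | k
      · rw [← totalDegree_zero_iff_isHomogeneous, totalDegree_eq_zero_iff_eq_C] at hg
        rw [hg, pderiv_C, mul_zero, map_zero]
      · exact ih hf.pderiv (by rw [polyLap_pderiv, hlap, map_zero]) hg.pderiv (by omega)
    have hE : gaussianIntegral ((∑ i, X i * pderiv i f) * g) = 0 := by
      have : ∀ i, gaussianIntegral (X i * pderiv i f * g) =
          gaussianIntegral (pderiv i (pderiv i f) * g) := by
        intro i
        rw [mul_assoc, gaussianIntegral_X_mul, pderiv_mul, map_add, hterm i, add_zero]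
      rw [Finset.sum_mul, map_sum, Finset.sum_congr rfl fun i _ => this i, ← map_sum,
        ← Finset.sum_mul]
      change gaussianIntegral (polyLap f * g) = 0
      rw [hlap, zero_mul, map_zero]
    rw [hf.sum_X_mul_pderiv, smul_mul_assoc, map_nsmul] at hE
    exact (smul_eq_zero.1 hE).resolve_left m.succ_ne_zero

end MvPolynomial

/-- For `p = ∑_{j<n-1} x_j²/a_j² − 1`, if `Δ(p·q) = 0` identically then `q = 0`:
the Fischer operator has trivial kernel. -/
theorem fischer_operator_injective
    (n : ℕ) (hn : 2 ≤ n) (a : Fin (n - 1) → ℝ) (ha : ∀ j, 0 < a j)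
    (q : MvPolynomial (Fin n) ℝ)
    (h : polyLap (((∑ j : Fin (n - 1),
        C ((a j) ^ 2)⁻¹ * (X (Fin.castLE (Nat.sub_le n 1) j)) ^ 2) - 1) * q) = 0) :
    q = 0 := by
  by_contra hq
  set P : MvPolynomial (Fin n) ℝ := ∑ j : Fin (n - 1),
    C ((a j) ^ 2)⁻¹ * (X (Fin.castLE (Nat.sub_le n 1) j)) ^ 2 with hP
  have hPhom : P.IsHomogeneous 2 := IsHomogeneous.sum _ _ _ fun j _ => by
    simpa using (isHomogeneous_C (Fin n) ((a j) ^ 2)⁻¹).mul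
      ((isHomogeneous_X ℝ (Fin.castLE (Nat.sub_le n 1) j)).pow 2)
  set d := q.totalDegree
  set g := homogeneousComponent d q with hg
  have hghom : g.IsHomogeneous d := homogeneousComponent_isHomogeneous d q
  have hlap : polyLap (P * g) = 0 := by
    have h' := homogeneousComponent_polyLap d ((P - 1) * q)
    rw [h, map_zero, sub_mul, one_mul, map_sub, hPhom.homogeneousComponent_mul,
      homogeneousComponent_eq_zero (d + 2) q (by omega), sub_zero] at h'
    exact h'.symm
  have hzero := gaussianIntegral_mul_eq_zero_of_polyLap_eq_zero (hPhom.mul hghom) hlap hghom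
    (by omega)
  have hsum : P * g * g = ∑ j : Fin (n - 1),
      ((a j) ^ 2)⁻¹ • (X (Fin.castLE (Nat.sub_le n 1) j) * g) ^ 2 := by
    rw [hP, mul_assoc, Finset.sum_mul]
    refine Finset.sum_congr rfl fun j _ => ?_
    rw [smul_eq_C_mul]
    ring
  rw [hsum, map_sum, Finset.sum_eq_zero_iff_of_nonneg fun j _ => by
    rw [map_smul]
    exact mul_nonneg (by positivity) (gaussianIntegral_sq_nonneg _)] at hzero
  let j : Fin (n - 1) := ⟨0, by omega⟩
  have hj := hzero j (Finset.mem_univ j)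
  rw [map_smul, smul_eq_zero] at hj
  have hXg := eq_zero_of_gaussianIntegral_sq_eq_zero
    (hj.resolve_left (inv_ne_zero (pow_ne_zero 2 (ha j).ne')))
  have hg0 : g = 0 := (mul_eq_zero.1 hXg).resolve_left (X_ne_zero _)
  obtain ⟨α, hα, hαd⟩ := Finset.exists_mem_eq_sup q.support (support_nonempty.2 hq)
    fun s : Fin n →₀ ℕ => s.degree
  have hαdeg : α.degree = d := hαd.symm
  have hcoeff : coeff α g = coeff α q := by
    rw [hg, coeff_homogeneousComponent, if_pos hαdeg]
  rw [hg0, coeff_zero] at hcoeff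
  exact mem_support_iff.1 hα hcoeff.symm
end

section
/- Let δ > 0, B > 0, C > 0, and let s ≥ 0 be a real exponent. Suppose (a_m)_{m≥1} is a sequence of nonnegative real numbers such that a_m ≤ C · B^m · m! / m^{m(1+δ)} for all sufficiently large m. Then for every sufficiently large j the series Σ_{m=j}^∞ a_m converges, and lim_{j→∞} ( j^{s} · Σ_{m=j}^∞ a_m )^{1/j} = 0. -/
open Filter

/-- The terms `B ^ m * m! / m ^ (m * (1 + δ))` decay faster than any geometric sequence. -/
lemma eventually_pow_mul_factorial_div_rpow_le_pow {δ B ε : ℝ} (hδ : 0 < δ) (hB : 0 < B)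
    (hε : 0 < ε) :
    ∀ᶠ m : ℕ in atTop,
      B ^ m * (Nat.factorial m) / (m : ℝ) ^ ((m : ℝ) * (1 + δ)) ≤ ε ^ m := by
  have hlarge : ∀ᶠ m : ℕ in atTop, B / ε ≤ (m : ℝ) ^ δ :=
    ((tendsto_rpow_atTop hδ).comp tendsto_natCast_atTop_atTop).eventually_ge_atTop (B / ε)
  filter_upwards [hlarge, eventually_gt_atTop 0] with m hm hm0
  have hmpos : (0 : ℝ) < m := by exact_mod_cast hm0
  have hsplit : (m : ℝ) ^ ((m : ℝ) * (1 + δ)) = (m : ℝ) ^ m * ((m : ℝ) ^ δ) ^ m := by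
    rw [mul_comm, Real.rpow_mul_natCast hmpos.le, Real.rpow_add hmpos, Real.rpow_one, mul_pow]
  have hfact : (Nat.factorial m : ℝ) ≤ (m : ℝ) ^ m := by exact_mod_cast Nat.factorial_le_pow m
  have hBm : B ^ m ≤ (ε * (m : ℝ) ^ δ) ^ m := by
    rw [div_le_iff₀' hε] at hm
    gcongr
  rw [div_le_iff₀ (by positivity), hsplit]
  calc B ^ m * (Nat.factorial m) ≤ (ε * (m : ℝ) ^ δ) ^ m * (m : ℝ) ^ m := by gcongr
    _ = ε ^ m * ((m : ℝ) ^ m * ((m : ℝ) ^ δ) ^ m) := by ring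

/-- Tails of a sequence that is eventually dominated by a geometric one. -/
lemma eventually_summable_and_tsum_tail_le {a : ℕ → ℝ} {C ε : ℝ} (hε : 0 ≤ ε) (hε1 : ε < 1)
    (h0 : ∀ᶠ m in atTop, 0 ≤ a m) (h : ∀ᶠ m in atTop, a m ≤ C * ε ^ m) :
    ∀ᶠ j : ℕ in atTop, (Summable fun m : ℕ => a (j + m)) ∧
      ∑' m : ℕ, a (j + m) ≤ C * (1 - ε)⁻¹ * ε ^ j := by
  filter_upwards [eventually_forall_ge_atTop.2 h0, eventually_forall_ge_atTop.2 h] with j hj0 hj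
  have hgeom : HasSum (fun m : ℕ => C * ε ^ j * ε ^ m) (C * ε ^ j * (1 - ε)⁻¹) :=
    (hasSum_geometric_of_lt_one hε hε1).mul_left _
  have hle (m : ℕ) : a (j + m) ≤ C * ε ^ j * ε ^ m :=
    (hj (j + m) (Nat.le_add_right j m)).trans_eq (by ring)
  have hsum : Summable fun m : ℕ => a (j + m) :=
    hgeom.summable.of_nonneg_of_le (fun m => hj0 (j + m) (Nat.le_add_right j m)) hle
  exact ⟨hsum, (hsum.tsum_le_tsum hle hgeom.summable).trans_eq (by rw [hgeom.tsum_eq]; ring)⟩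

/-- Power and constant factors disappear in the root test. -/
lemma tendsto_rpow_mul_const_rpow_one_div (s : ℝ) {K : ℝ} (hK : 0 < K) :
    Tendsto (fun j : ℕ => ((j : ℝ) ^ s * K) ^ (1 / (j : ℝ))) atTop (nhds 1) := by
  have hroot : Tendsto (fun j : ℕ => ((j : ℝ) ^ (1 / (j : ℝ))) ^ s) atTop (nhds 1) := by
    simpa using (tendsto_rpow_div.comp tendsto_natCast_atTop_atTop).rpow_const
      (p := s) (Or.inl one_ne_zero)
  have hconst : Tendsto (fun j : ℕ => K ^ (1 / (j : ℝ))) atTop (nhds 1) := by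
    simpa using tendsto_const_nhds.rpow (tendsto_one_div_atTop_nhds_zero_nat (𝕜 := ℝ))
      (Or.inl hK.ne')
  have hprod := hroot.mul hconst
  rw [one_mul] at hprod
  refine hprod.congr fun j => ?_
  have hj : (0 : ℝ) ≤ j := j.cast_nonneg
  rw [Real.mul_rpow (by positivity) hK.le, ← Real.rpow_mul hj, ← Real.rpow_mul hj,
    mul_comm s]

/-- Key summation estimate: if `a_m ≤ C·B^m·m!/m^{m(1+δ)}` for large `m`, then the tails
`∑_{m=j}^∞ a_m` converge for large `j` and `(j^s · ∑_{m=j}^∞ a_m)^{1/j} → 0` as `j → ∞`. -/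
theorem tail_sum_estimate
    (δ B C s : ℝ) (hδ : 0 < δ) (hB : 0 < B) (hC : 0 < C) (hs : 0 ≤ s)
    (a : ℕ → ℝ) (ha : ∀ m : ℕ, 1 ≤ m → 0 ≤ a m)
    (hbd : ∀ᶠ m : ℕ in atTop,
      a m ≤ C * B ^ m * (Nat.factorial m) / (m : ℝ) ^ ((m : ℝ) * (1 + δ))) :
    (∀ᶠ j : ℕ in atTop, Summable fun m : ℕ => a (j + m)) ∧
    Tendsto (fun j : ℕ => ((j : ℝ) ^ s * ∑' m : ℕ, a (j + m)) ^ (1 / (j : ℝ)))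
      atTop (nhds 0) := by
  have htail {ε : ℝ} (hε : 0 < ε) (hε1 : ε < 1) :
      ∀ᶠ j : ℕ in atTop, (Summable fun m : ℕ => a (j + m)) ∧
        ∑' m : ℕ, a (j + m) ≤ C * (1 - ε)⁻¹ * ε ^ j := by
    refine eventually_summable_and_tsum_tail_le hε.le hε1 ((eventually_ge_atTop 1).mono ha) ?_
    filter_upwards [hbd, eventually_pow_mul_factorial_div_rpow_le_pow hδ hB hε] with m hm hmε
    calc a m ≤ C * (B ^ m * (Nat.factorial m) / (m : ℝ) ^ ((m : ℝ) * (1 + δ))) :=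
          hm.trans_eq (by ring)
      _ ≤ C * ε ^ m := by gcongr
  have hnonneg {j : ℕ} (hj : 1 ≤ j) : 0 ≤ (j : ℝ) ^ s * ∑' m : ℕ, a (j + m) :=
    mul_nonneg (by positivity) (tsum_nonneg fun m => ha _ (hj.trans (Nat.le_add_right j m)))
  refine ⟨(htail one_half_pos one_half_lt_one).mono fun j hj => hj.1, ?_⟩
  refine tendsto_order.2 ⟨fun b hb => ?_, fun b hb => ?_⟩
  · filter_upwards [eventually_ge_atTop 1] with j hj
    exact hb.trans_le (Real.rpow_nonneg (hnonneg hj) _)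
  · obtain ⟨ε, hε, hεb⟩ := exists_between (lt_min hb one_pos)
    obtain ⟨hεb, hε1⟩ := lt_min_iff.1 hεb
    have hK : 0 < C * (1 - ε)⁻¹ := mul_pos hC (inv_pos.2 (sub_pos.2 hε1))
    have hlim := (tendsto_rpow_mul_const_rpow_one_div s hK).mul_const ε
    rw [one_mul] at hlim
    filter_upwards [htail hε hε1, eventually_ge_atTop 1, hlim.eventually_lt_const hεb]
      with j hj hj1 hjb
    refine lt_of_le_of_lt ?_ hjb
    calc ((j : ℝ) ^ s * ∑' m : ℕ, a (j + m)) ^ (1 / (j : ℝ))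
        ≤ ((j : ℝ) ^ s * (C * (1 - ε)⁻¹) * ε ^ j) ^ (1 / (j : ℝ)) := by
          refine Real.rpow_le_rpow (hnonneg hj1) ?_ (by positivity)
          rw [mul_assoc]
          exact mul_le_mul_of_nonneg_left hj.2 (by positivity)
      _ = ((j : ℝ) ^ s * (C * (1 - ε)⁻¹)) ^ (1 / (j : ℝ)) * ε := by
          rw [Real.mul_rpow (by positivity) (by positivity), one_div,
            Real.pow_rpow_inv_natCast hε.le (by lia)]
end
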